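/- For every p ∈ (1,∞) there exists a separable Banach space U_p which admits an equivalent p-AUS norm and which is both injectively and surjectively universal for the class of separable p-AUS-able spaces: every separable Banach space admitting an equivalent p-AUS norm is isomorphic to a closed subspace of U_p, and is also a quotient of U_p (i.e., there is a surjective bounded linear map from U_p onto it). -/

import Mathlib

open Metric Set Topology Filter

noncomputable def rhoN (X : Type*) [NormedAddCommGroup X] [NormedSpace ℝ X]
    (N : X → ℝ) (τ : ℝ) : ℝ :=
  letI := Classical.propDecidable (FiniteDimensional ℝ X)
  if FiniteDimensional ℝ X then 0
  else
    sSup { r : ℝ | ∃ y : X, N y ≤ 1 ∧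
      r = sInf { s : ℝ | ∃ E : Submodule ℝ X, IsClosed (E : Set X) ∧
            FiniteDimensional ℝ (X ⧸ E) ∧
            s = sSup { t : ℝ | ∃ x ∈ E, N x ≤ 1 ∧ t = N (y + τ • x) - 1 } } }

noncomputable def rho (X : Type*) [NormedAddCommGroup X] [NormedSpace ℝ X] (τ : ℝ) : ℝ :=
  rhoN X (fun x => ‖x‖) τ

def IsNormFn (X : Type*) [NormedAddCommGroup X] [NormedSpace ℝ X] (N : X → ℝ) : Prop :=
  (∀ x : X, 0 ≤ N x) ∧ (∀ x : X, N x = 0 ↔ x = 0) ∧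
    (∀ (a : ℝ) (x : X), N (a • x) = |a| * N x) ∧ ∀ x y : X, N (x + y) ≤ N x + N y

def IsEquivNorm (X : Type*) [NormedAddCommGroup X] [NormedSpace ℝ X] (N : X → ℝ) : Prop :=
  IsNormFn X N ∧ ∃ a > 0, ∃ b > 0, ∀ x : X, a * ‖x‖ ≤ N x ∧ N x ≤ b * ‖x‖

def IsPAUSNorm (X : Type*) [NormedAddCommGroup X] [NormedSpace ℝ X] (N : X → ℝ) (p : ℝ) : Prop :=
  ∃ C > 0, ∀ τ : ℝ, 0 ≤ τ → rhoN X N τ ≤ C * τ ^ p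

def PAUSable (p : ℝ) (X : Type*) [NormedAddCommGroup X] [NormedSpace ℝ X] : Prop :=
  ∃ N : X → ℝ, IsEquivNorm X N ∧ IsPAUSNorm X N p

def IsomToClosedSubspace (Y U : Type*) [NormedAddCommGroup Y] [NormedSpace ℝ Y]
    [NormedAddCommGroup U] [NormedSpace ℝ U] : Prop :=
  ∃ T : Y →L[ℝ] U, Function.Injective T ∧ ∃ c > 0, ∀ y : Y, c * ‖y‖ ≤ ‖T y‖

def IsQuotientOf (Y U : Type*) [NormedAddCommGroup Y] [NormedSpace ℝ Y]
    [NormedAddCommGroup U] [NormedSpace ℝ U] : Prop :=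
  ∃ Q : U →L[ℝ] Y, Function.Surjective Q


universe u

section Renorming

/-- Asymptotic uniform smoothness of power type `p` with constant `C`, unfolded. -/
def AUSWith (C p : ℝ) (X : Type*) [NormedAddCommGroup X] [NormedSpace ℝ X] : Prop :=
  ∀ y : X, ‖y‖ ≤ 1 → ∀ τ : ℝ, 0 ≤ τ → ∀ η : ℝ, 0 < η →
    ∃ E : Submodule ℝ X, IsClosed (E : Set X) ∧ FiniteDimensional ℝ (X ⧸ E) ∧
      ∀ x ∈ E, ‖x‖ ≤ 1 → ‖y + τ • x‖ ≤ 1 + C * τ ^ p + η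

variable {X : Type*} [NormedAddCommGroup X] [NormedSpace ℝ X]

theorem IsNormFn.add_smul_le {N : X → ℝ} (hN : IsNormFn X N) {x y : X} {τ : ℝ} (hτ : 0 ≤ τ)
    (hy : N y ≤ 1) (hx : N x ≤ 1) : N (y + τ • x) ≤ 1 + τ := by
  have h1 := hN.2.2.2 y (τ • x)
  have h2 := hN.2.2.1 τ x
  rw [abs_of_nonneg hτ] at h2
  nlinarith

theorem IsNormFn.bddAbove_tail {N : X → ℝ} (hN : IsNormFn X N) {y : X} {τ : ℝ} (hτ : 0 ≤ τ)
    (hy : N y ≤ 1) (E : Submodule ℝ X) :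
    BddAbove { t : ℝ | ∃ x ∈ E, N x ≤ 1 ∧ t = N (y + τ • x) - 1 } := by
  refine ⟨τ, ?_⟩
  rintro t ⟨x, -, hx, rfl⟩
  linarith [hN.add_smul_le hτ hy hx]

theorem IsNormFn.neg_one_le_sSup_tail {N : X → ℝ} (hN : IsNormFn X N) {y : X} {τ : ℝ}
    (hτ : 0 ≤ τ) (hy : N y ≤ 1) (E : Submodule ℝ X) :
    -1 ≤ sSup { t : ℝ | ∃ x ∈ E, N x ≤ 1 ∧ t = N (y + τ • x) - 1 } := by
  have h0 : N 0 = 0 := (hN.2.1 0).2 rfl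
  have h : N y - 1 ∈ { t : ℝ | ∃ x ∈ E, N x ≤ 1 ∧ t = N (y + τ • x) - 1 } :=
    ⟨0, E.zero_mem, by simp [h0], by simp⟩
  have := le_csSup (hN.bddAbove_tail hτ hy E) h
  linarith [hN.1 y]

theorem IsNormFn.norm : IsNormFn X (fun x => ‖x‖) :=
  ⟨norm_nonneg, fun _ => norm_eq_zero, fun a x => by simp [norm_smul], norm_add_le⟩

theorem AUSWith.pAUSable {C p : ℝ} (hC : 0 < C) (h : AUSWith C p X) : PAUSable p X := by
  refine ⟨fun x => ‖x‖, ⟨IsNormFn.norm, 1, one_pos, 1, one_pos, fun x => by simp⟩, C, hC,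
    fun τ hτ => ?_⟩
  have hpos : 0 ≤ C * τ ^ p := by positivity
  unfold rhoN
  split_ifs with hfd
  · exact hpos
  refine Real.sSup_le ?_ hpos
  rintro r ⟨y, hy, rfl⟩
  refine le_of_forall_pos_le_add fun η hη => ?_
  obtain ⟨E, hE, hEf, hEb⟩ := h y hy τ hτ η hη
  refine csInf_le_of_le ?_ ⟨E, hE, hEf, rfl⟩ ?_
  · refine ⟨-1, ?_⟩
    rintro s ⟨E', -, -, rfl⟩
    exact IsNormFn.norm.neg_one_le_sSup_tail hτ hy E'
  · refine Real.sSup_le ?_ (by linarith)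
    rintro t ⟨x, hx, hx1, rfl⟩
    have := hEb x hx hx1
    linarith

theorem IsPAUSNorm.exists_tail {N : X → ℝ} {p : ℝ} (hN : IsNormFn X N) (h : IsPAUSNorm X N p) :
    ∃ C : ℝ, 1 ≤ C ∧ ∀ y : X, N y ≤ 1 → ∀ τ : ℝ, 0 ≤ τ → ∀ η : ℝ, 0 < η →
      ∃ E : Submodule ℝ X, IsClosed (E : Set X) ∧ FiniteDimensional ℝ (X ⧸ E) ∧
        ∀ x ∈ E, N x ≤ 1 → N (y + τ • x) ≤ 1 + C * τ ^ p + η := by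
  obtain ⟨C, hC, h⟩ := h
  refine ⟨max C 1, le_max_right _ _, fun y hy τ hτ η hη => ?_⟩
  have hle : C * τ ^ p ≤ max C 1 * τ ^ p := by gcongr; exact le_max_left _ _
  have hpos : 0 ≤ max C 1 * τ ^ p := by positivity
  by_cases hfd : FiniteDimensional ℝ X
  · refine ⟨⊥, isClosed_singleton, inferInstance, fun x hx _ => ?_⟩
    rw [(Submodule.mem_bot ℝ).1 hx]
    simp only [smul_zero, add_zero]
    linarith
  have h1 := h τ hτ
  unfold rhoN at h1
  rw [if_neg hfd] at h1
  set S : X → Set ℝ := fun y => { s : ℝ | ∃ E : Submodule ℝ X, IsClosed (E : Set X) ∧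
            FiniteDimensional ℝ (X ⧸ E) ∧
            s = sSup { t : ℝ | ∃ x ∈ E, N x ≤ 1 ∧ t = N (y + τ • x) - 1 } } with hS
  have htop : ∀ y, sSup { t : ℝ | ∃ x ∈ (⊤ : Submodule ℝ X), N x ≤ 1 ∧
      t = N (y + τ • x) - 1 } ∈ S y := fun y =>
    ⟨⊤, isClosed_univ, inferInstance, rfl⟩
  have hbdd : ∀ y, N y ≤ 1 → BddBelow (S y) := by
    intro y hy
    refine ⟨-1, ?_⟩
    rintro s ⟨E', -, -, rfl⟩
    exact hN.neg_one_le_sSup_tail hτ hy E'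
  have h2 : sInf (S y) ≤ C * τ ^ p := by
    refine le_trans ?_ h1
    refine le_csSup ?_ ⟨y, hy, rfl⟩
    refine ⟨τ, ?_⟩
    rintro r ⟨z, hz, rfl⟩
    refine (csInf_le (hbdd z hz) (htop z)).trans (Real.sSup_le ?_ hτ)
    rintro t ⟨x, -, hx, rfl⟩
    linarith [hN.add_smul_le hτ hz hx]
  obtain ⟨s, ⟨E, hE, hEf, rfl⟩, hs⟩ :=
    exists_lt_of_csInf_lt ⟨_, htop y⟩ (lt_of_le_of_lt h2 (lt_add_of_pos_right _ hη))
  refine ⟨E, hE, hEf, fun x hx hx1 => ?_⟩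
  have := le_csSup (hN.bddAbove_tail hτ hy E) ⟨x, hx, hx1, rfl⟩
  linarith

/-- The space `X` endowed with another norm. -/
def Renormed (X : Type u) (_N : X → ℝ) : Type u := X

theorem exists_renorming {X : Type u} [NormedAddCommGroup X] [NormedSpace ℝ X] {N : X → ℝ}
    (hN : IsEquivNorm X N) :
    ∃ (Y : Type u) (_ : NormedAddCommGroup Y) (_ : NormedSpace ℝ Y) (e : X ≃L[ℝ] Y),
      ∀ x, ‖e x‖ = N x := by
  obtain ⟨hN, a, ha, b, hb, hab⟩ := hN
  let i1 : AddCommGroup (Renormed X N) := inferInstanceAs (AddCommGroup X)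
  let i2 : Module ℝ (Renormed X N) := inferInstanceAs (Module ℝ X)
  let i3 : Norm (Renormed X N) := ⟨N⟩
  have core : NormedSpace.Core ℝ (Renormed X N) :=
    { norm_nonneg := hN.1
      norm_smul := hN.2.2.1
      norm_triangle := hN.2.2.2
      norm_eq_zero_iff := hN.2.1 }
  let i4 : NormedAddCommGroup (Renormed X N) := NormedAddCommGroup.ofCore core
  let i5 : NormedSpace ℝ (Renormed X N) := NormedSpace.ofCore core
  let e : X ≃ₗ[ℝ] Renormed X N := LinearEquiv.refl ℝ X
  have he : ∀ x, ‖e x‖ = N x := fun x => rfl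
  refine ⟨Renormed X N, i4, i5, e.toContinuousLinearEquivOfBounds b a⁻¹ (fun x => (hab x).2) ?_, he⟩
  intro y
  rw [le_inv_mul_iff₀ ha]
  exact (hab (e.symm y)).1

theorem PAUSable.exists_renorming {p : ℝ} {X : Type u} [NormedAddCommGroup X] [NormedSpace ℝ X]
    (h : PAUSable p X) :
    ∃ (Y : Type u) (_ : NormedAddCommGroup Y) (_ : NormedSpace ℝ Y) (_ : X ≃L[ℝ] Y) (C : ℝ),
      1 ≤ C ∧ AUSWith C p Y := by
  obtain ⟨N, hN, hp⟩ := h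
  obtain ⟨C, hC, hp⟩ := hp.exists_tail hN.1
  obtain ⟨Y, i1, i2, e, he⟩ := _root_.exists_renorming hN
  refine ⟨Y, i1, i2, e, C, hC, fun y hy τ hτ η hη => ?_⟩
  obtain ⟨E, hE, hEf, hEb⟩ := hp (e.symm y) (by rw [← he]; simpa using hy) τ hτ η hη
  refine ⟨E.comap (e.symm : Y →ₗ[ℝ] X), hE.preimage e.symm.continuous, ?_, fun x hx hx1 => ?_⟩
  · have hm : E = (E.comap (e.symm : Y →ₗ[ℝ] X)).comap (e : X →ₗ[ℝ] Y) := by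
      ext x; simp
    refine Module.Finite.of_surjective
      (Submodule.mapQ E (E.comap (e.symm : Y →ₗ[ℝ] X)) (e : X →ₗ[ℝ] Y) hm.le) ?_
    intro z
    obtain ⟨z, rfl⟩ := Submodule.mkQ_surjective _ z
    exact ⟨Submodule.Quotient.mk (e.symm z), by
      rw [Submodule.mapQ_apply]; simp; rfl⟩
  · have := hEb (e.symm x) hx (by rw [← he]; simpa using hx1)
    rw [← he] at this
    simpa using this

theorem AUSWith.prod {C p : ℝ} {X Y : Type*} [NormedAddCommGroup X] [NormedSpace ℝ X]
    [NormedAddCommGroup Y] [NormedSpace ℝ Y] (hX : AUSWith C p X) (hY : AUSWith C p Y) :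
    AUSWith C p (X × Y) := by
  intro y hy τ hτ η hη
  obtain ⟨E, hE, hEf, hEb⟩ := hX y.1 ((norm_fst_le y).trans hy) τ hτ η hη
  obtain ⟨F, hF, hFf, hFb⟩ := hY y.2 ((norm_snd_le y).trans hy) τ hτ η hη
  refine ⟨E.prod F, hE.prod hF, ?_, fun x hx hx1 => ?_⟩
  · have hk : E.prod F = LinearMap.ker (E.mkQ.prodMap F.mkQ) := by
      ext x; simp
    rw [hk]
    exact Module.Finite.equiv (LinearMap.quotKerEquivRange (E.mkQ.prodMap F.mkQ)).symm
  · rw [Prod.norm_def]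
    exact max_le (hEb x.1 hx.1 ((norm_fst_le x).trans hx1))
      (hFb x.2 hx.2 ((norm_snd_le x).trans hx1))

end Renorming

section Tails

variable {X : Type*} [NormedAddCommGroup X] [NormedSpace ℝ X]

/-- A closed subspace of finite codimension. -/
def IsTail (E : Submodule ℝ X) : Prop := IsClosed (E : Set X) ∧ FiniteDimensional ℝ (X ⧸ E)

theorem IsTail.top : IsTail (⊤ : Submodule ℝ X) := ⟨isClosed_univ, inferInstance⟩

theorem IsTail.inf {E F : Submodule ℝ X} (hE : IsTail E) (hF : IsTail F) : IsTail (E ⊓ F) :=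
  ⟨hE.1.inter hF.1, Submodule.CoFG.inf hE.2 hF.2⟩

theorem IsTail.ker (g : StrongDual ℝ X) : IsTail (LinearMap.ker (g : X →ₗ[ℝ] ℝ)) :=
  ⟨g.isClosed_ker, Module.Finite.equiv (LinearMap.quotKerEquivRange (g : X →ₗ[ℝ] ℝ)).symm⟩

theorem Set.Finite.exists_isTail {ι : Type*} {s : Set ι} (hs : s.Finite)
    {P : ι → Submodule ℝ X → Prop} (hP : ∀ i ∈ s, ∃ E, IsTail E ∧ P i E)
    (hmono : ∀ i E F, F ≤ E → P i E → P i F) : ∃ E, IsTail E ∧ ∀ i ∈ s, P i E := by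
  induction s, hs using Set.Finite.induction_on with
  | empty => exact ⟨⊤, IsTail.top, by simp⟩
  | @insert a s _ _ ih =>
    obtain ⟨E, hE, hEP⟩ := ih fun i hi => hP i (mem_insert_of_mem _ hi)
    obtain ⟨F, hF, hFP⟩ := hP a (mem_insert _ _)
    refine ⟨E ⊓ F, hE.inf hF, fun i hi => ?_⟩
    rcases hi with rfl | hi
    · exact hmono _ _ _ inf_le_right hFP
    · exact hmono _ _ _ inf_le_left (hEP i hi)

theorem IsTail.exists_finite_net {E : Submodule ℝ X} (hE : IsTail E) {s : Set X}
    (hs : s ⊆ closedBall 0 1) {η : ℝ} (hη : 0 < η) :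
    ∃ G : Set X, G.Finite ∧ G ⊆ s ∧ ∀ x ∈ s, ∃ u ∈ G, ∃ h ∈ E, ‖x - u - h‖ ≤ η := by
  have := hE.1
  have := hE.2
  have : ProperSpace (X ⧸ E) := FiniteDimensional.proper_real _
  have htb : TotallyBounded (E.mkQ '' s) := by
    refine TotallyBounded.subset ?_ (isCompact_closedBall (0 : X ⧸ E) 1).totallyBounded
    rintro _ ⟨x, hx, rfl⟩
    have := hs hx
    rw [mem_closedBall_zero_iff] at this ⊢
    exact (Submodule.Quotient.norm_mk_le E x).trans this
  obtain ⟨t, hts, htf, ht⟩ := totallyBounded_iff_subset.1 htb _ (dist_mem_uniformity hη)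
  obtain ⟨G, hGs, hGf, rfl⟩ := exists_subset_image_finite_and.1 ⟨t, hts, htf, rfl⟩
  refine ⟨G, hGf, hGs, fun x hx => ?_⟩
  have := ht (mem_image_of_mem E.mkQ hx)
  simp only [mem_iUnion, exists_prop, mem_ofPred_eq] at this
  obtain ⟨_, ⟨u, hu, rfl⟩, hd⟩ := this
  refine ⟨u, hu, ?_⟩
  rw [dist_eq_norm, ← map_sub] at hd
  obtain ⟨m, hm, hmn⟩ := Submodule.Quotient.norm_mk_lt (E.mkQ (x - u)) (sub_pos.2 hd)
  refine ⟨x - u - m, ?_, ?_⟩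
  · rw [← Submodule.Quotient.mk_eq_zero, Submodule.Quotient.mk_sub, hm]
    simp
  · rw [sub_sub_cancel]
    linarith

end Tails

section Smoothness

variable {X : Type*} [NormedAddCommGroup X] [NormedSpace ℝ X] {C p : ℝ}

/-- The sharp form of asymptotic smoothness, uniformly over totally bounded sets. -/
def SharpAUS (C p : ℝ) (X : Type*) [NormedAddCommGroup X] [NormedSpace ℝ X] : Prop :=
  ∀ s : Set X, TotallyBounded s → s ⊆ closedBall 0 1 → ∀ η : ℝ, 0 < η →
    ∃ E : Submodule ℝ X, IsTail E ∧ ∀ y ∈ s, ∀ x ∈ E, ‖x‖ ≤ 1 → ∀ σ τ : ℝ, 0 ≤ σ → σ ≤ 1 → 0 ≤ τ →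
      ‖σ • y + τ • x‖ ≤ (σ ^ p + C * τ ^ p) ^ (1 / p) + η

theorem AUSWith.exists_tail_finite (h : AUSWith C p X) {s : Set X} (hs : s.Finite)
    (hs1 : s ⊆ closedBall 0 1) {τ η : ℝ} (hτ : 0 ≤ τ) (hη : 0 < η) :
    ∃ E : Submodule ℝ X, IsTail E ∧ ∀ y ∈ s, ∀ x ∈ E, ‖x‖ ≤ 1 →
      ‖y + τ • x‖ ≤ 1 + C * τ ^ p + η := by
  refine hs.exists_isTail (P := fun y E => ∀ x ∈ E, ‖x‖ ≤ 1 → ‖y + τ • x‖ ≤ 1 + C * τ ^ p + η)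
    (fun y hy => ?_) (fun y E F hEF hE x hx => hE x (hEF hx))
  obtain ⟨E, h1, h2, h3⟩ := h y (by simpa using hs1 hy) τ hτ η hη
  exact ⟨E, ⟨h1, h2⟩, h3⟩

theorem AUSWith.exists_tail_unit (hp : 0 < p) (hC : 0 ≤ C) (h : AUSWith C p X) {s : Set X}
    (hs : s.Finite) (hs1 : s ⊆ closedBall 0 1) {η : ℝ} (hη : 0 < η) :
    ∃ E : Submodule ℝ X, IsTail E ∧ ∀ y ∈ s, ∀ x ∈ E, ‖x‖ ≤ 1 → ∀ τ : ℝ, 0 ≤ τ → τ ≤ 1 →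
      ‖y + τ • x‖ ≤ 1 + C * τ ^ p + η := by
  obtain ⟨N, hN⟩ := exists_nat_gt (2 / η)
  have hN0 : (0 : ℝ) < N := lt_trans (by positivity) hN
  obtain ⟨E, hE, hEb⟩ := (finite_Iic N).exists_isTail
    (P := fun i E => ∀ y ∈ s, ∀ x ∈ E, ‖x‖ ≤ 1 →
      ‖y + ((i : ℝ) / N) • x‖ ≤ 1 + C * ((i : ℝ) / N) ^ p + η / 2)
    (fun i _ => h.exists_tail_finite hs hs1 (by positivity) (by positivity))
    (fun i E F hEF hE y hy x hx => hE y hy x (hEF hx))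
  refine ⟨E, hE, fun y hy x hx hx1 τ hτ hτ1 => ?_⟩
  have hfl : (⌊τ * N⌋₊ : ℝ) ≤ τ * N := Nat.floor_le (by positivity)
  have hfl' : τ * N < ⌊τ * N⌋₊ + 1 := Nat.lt_floor_add_one _
  have hi : ⌊τ * N⌋₊ ≤ N := by
    have : (⌊τ * N⌋₊ : ℝ) ≤ N := hfl.trans (by nlinarith)
    exact_mod_cast this
  set i := ⌊τ * N⌋₊
  have h1 := hEb i hi y hy x hx hx1
  have h2 : (i : ℝ) / N ≤ τ := (div_le_iff₀ hN0).2 hfl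
  have h3 : τ - i / N ≤ η / 2 := by
    have h4 : τ ≤ (i + 1 : ℝ) / N := (le_div_iff₀ hN0).2 hfl'.le
    have h5 : 1 / (N : ℝ) ≤ η / 2 := by
      rw [div_le_iff₀ hN0]
      rw [div_lt_iff₀ hη] at hN
      linarith
    rw [add_div] at h4
    linarith
  have h6 : ((i : ℝ) / N) ^ p ≤ τ ^ p := by gcongr
  have h7 : y + τ • x = (y + ((i : ℝ) / N) • x) + (τ - i / N) • x := by
    rw [sub_smul]; abel
  have h8 : ‖(τ - i / N) • x‖ ≤ η / 2 := by
    rw [norm_smul, Real.norm_of_nonneg (by linarith)]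
    nlinarith [norm_nonneg x]
  rw [h7]
  refine (norm_add_le _ _).trans ?_
  nlinarith [mul_le_mul_of_nonneg_left h6 hC]

theorem one_add_mul_le_rpow (hp : 1 < p) (hC : 0 ≤ C) {s : ℝ} (hs : 0 ≤ s) (hs1 : s ≤ 1) :
    1 + C * s ≤ (1 + (1 + C) ^ p * s) ^ (1 / p) := by
  have hp0 : 0 < p := by linarith
  rw [one_div, Real.le_rpow_inv_iff_of_pos (by positivity) (by positivity) hp0]
  have hconv := (convexOn_rpow hp.le).2 (x := 1) (y := 1 + C) (by simp)
    (by simp only [mem_Ici]; positivity) (sub_nonneg.2 hs1) hs (by ring)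
  simp only [smul_eq_mul, Real.one_rpow, mul_one] at hconv
  have : 1 - s + s * (1 + C) = 1 + C * s := by ring
  rw [this] at hconv
  linarith

theorem AUSWith.sharp (hp : 1 < p) (hC : 1 ≤ C) (h : AUSWith C p X) :
    SharpAUS ((1 + C) ^ p) p X := by
  have hp0 : 0 < p := by linarith
  intro s hs hs1 η hη
  obtain ⟨t, hts, htf, ht⟩ :=
    totallyBounded_iff_subset.1 hs _ (dist_mem_uniformity (half_pos hη))
  obtain ⟨E, hE, hEb⟩ := h.exists_tail_unit hp0 (by linarith) htf (hts.trans hs1) (half_pos hη)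
  refine ⟨E, hE, fun y hy x hx hx1 σ τ hσ hσ1 hτ => ?_⟩
  have hbase : ∀ τ : ℝ, 0 ≤ τ → ‖y + τ • x‖ ≤ (1 + (1 + C) ^ p * τ ^ p) ^ (1 / p) + η := by
    intro τ hτ
    rcases le_total τ 1 with hτ1 | hτ1
    · have hy' := ht hy
      simp only [mem_iUnion, exists_prop, mem_ofPred_eq] at hy'
      obtain ⟨u, hu, hd⟩ := hy'
      have h1 := hEb u hu x hx hx1 τ hτ hτ1
      have h2 : ‖y + τ • x‖ ≤ ‖u + τ • x‖ + ‖y - u‖ := by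
        have : y + τ • x = (u + τ • x) + (y - u) := by abel
        rw [this]
        exact norm_add_le _ _
      rw [dist_eq_norm] at hd
      have h3 := one_add_mul_le_rpow hp (zero_le_one.trans hC) (Real.rpow_nonneg hτ p)
        (Real.rpow_le_one hτ hτ1 hp0.le)
      linarith
    · have h1 : ‖y + τ • x‖ ≤ 1 + τ := by
        refine (norm_add_le _ _).trans ?_
        have := hs1 hy
        rw [mem_closedBall_zero_iff] at this
        rw [norm_smul, Real.norm_of_nonneg hτ]
        nlinarith
      have h2 : 1 + τ ≤ (1 + (1 + C) ^ p * τ ^ p) ^ (1 / p) := by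
        rw [one_div, Real.le_rpow_inv_iff_of_pos (by positivity) (by positivity) hp0,
          ← Real.mul_rpow (by positivity) hτ]
        have : (1 + τ) ^ p ≤ ((1 + C) * τ) ^ p := by
          gcongr
          nlinarith
        linarith
      linarith
  rcases hσ.eq_or_lt with rfl | hσ0
  · rw [zero_smul, zero_add, norm_smul, Real.norm_of_nonneg hτ, Real.zero_rpow hp0.ne', zero_add,
      ← Real.mul_rpow (by positivity) hτ, one_div, Real.rpow_rpow_inv (by positivity) hp0.ne']
    nlinarith
  · have h1 := hbase (τ / σ) (by positivity)
    have h2 : σ • y + τ • x = σ • (y + (τ / σ) • x) := by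
      rw [smul_add, smul_smul, mul_div_cancel₀ _ hσ0.ne']
    have h3 : σ * (1 + (1 + C) ^ p * (τ / σ) ^ p) ^ (1 / p)
        = (σ ^ p + (1 + C) ^ p * τ ^ p) ^ (1 / p) := by
      rw [one_div]
      nth_rewrite 1 [← Real.rpow_rpow_inv hσ hp0.ne']
      rw [← Real.mul_rpow (by positivity) (by positivity), Real.div_rpow hτ hσ]
      congr 1
      field_simp
    rw [h2, norm_smul, Real.norm_of_nonneg hσ, ← h3]
    nlinarith

end Smoothness

section Young

theorem rpow_add_mul_rpow_le {p q : ℝ} (hpq : p.HolderConjugate q) {C κ a b M η : ℝ}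
    (hC : 0 ≤ C) (hκ : 0 < κ) (hκ1 : κ ≤ 1) (hCκ : C * κ ^ p ≤ κ) (ha : 0 ≤ a) (ha1 : a ≤ 1)
    (hb : 0 ≤ b) (hb1 : b ≤ 1) (hM : 0 ≤ M)
    (H : ∀ σ τ : ℝ, 0 ≤ σ → σ ≤ 1 → 0 ≤ τ → τ ≤ 1 →
      σ * a + τ * b ≤ M * (σ ^ p + C * τ ^ p) ^ (1 / p) + η) :
    a ^ q + κ * b ^ q ≤ M ^ q + q * η := by
  have hp := hpq.pos
  have hq := hpq.symm.pos
  have hq1 := hpq.symm.lt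
  have key : ∀ x : ℝ, 0 ≤ x → x ^ (q - 1) * x = x ^ q := fun x hx => by
    rw [← Real.rpow_add_one' hx (by linarith), sub_add_cancel]
  have keyp : ∀ x : ℝ, 0 ≤ x → (x ^ (q - 1)) ^ p = x ^ q := fun x hx => by
    rw [← Real.rpow_mul hx, hpq.symm.sub_one_mul_conj]
  have h1 := H (a ^ (q - 1)) (κ * b ^ (q - 1)) (by positivity)
    (Real.rpow_le_one ha ha1 (by linarith)) (by positivity)
    (mul_le_one₀ hκ1 (by positivity) (Real.rpow_le_one hb hb1 (by linarith)))
  rw [mul_assoc, key a ha, key b hb, Real.mul_rpow hκ.le (by positivity), keyp a ha, keyp b hb,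
    ← mul_assoc] at h1
  set D := a ^ q + κ * b ^ q with hD
  have hD0 : 0 ≤ D := by positivity
  have h2 : (a ^ q + C * κ ^ p * b ^ q) ^ (1 / p) ≤ D ^ (1 / p) := by
    apply Real.rpow_le_rpow (by positivity) _ (by positivity)
    have : 0 ≤ b ^ q := by positivity
    nlinarith
  have h3 := Real.young_inequality_of_nonneg hM (Real.rpow_nonneg hD0 (1 / p)) hpq.symm
  rw [← Real.rpow_mul hD0, one_div_mul_cancel hp.ne', Real.rpow_one] at h3
  have h4 : D ≤ M ^ q / q + D / p + η := by
    have := mul_le_mul_of_nonneg_left h2 hM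
    linarith
  have h5 : D / p = D - D / q := by
    have := hpq.inv_add_inv_eq_one
    rw [div_eq_mul_inv, div_eq_mul_inv]
    have : p⁻¹ = 1 - q⁻¹ := by linarith
    rw [this]; ring
  have h6 : D / q ≤ M ^ q / q + η := by linarith
  have h7 : D / q * q ≤ (M ^ q / q + η) * q := by gcongr
  rw [add_mul, div_mul_cancel₀ _ hq.ne', div_mul_cancel₀ _ hq.ne'] at h7
  linarith

end Young

section Closure

variable {L : Type*} [NormedAddCommGroup L] [NormedSpace ℝ L]

theorem ausWith_one_topologicalClosure {p : ℝ} (hp : 1 ≤ p) {S : Submodule ℝ L}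
    {F E : ℕ → Submodule ℝ L} (hfd : ∀ n, FiniteDimensional ℝ (F n)) (hFS : ∀ n, F n ≤ S)
    (hSF : ∀ x ∈ S, ∃ n, x ∈ F n) (hsup : ∀ n, S ≤ F n ⊔ E n)
    (hsplit : ∀ n, ∃ m, ∀ x ∈ F n, ∀ y ∈ E m, ‖x + y‖ ^ p ≤ ‖x‖ ^ p + ‖y‖ ^ p) :
    AUSWith 1 p S.topologicalClosure := by
  have hp0 : 0 < p := by linarith
  intro y hy τ hτ η hη
  have hτp : 0 ≤ τ ^ p := by positivity
  set δ := η / (2 + τ ^ p) with hδ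
  have hδ0 : 0 < δ := by positivity
  obtain ⟨x, hxS, hxy⟩ := Metric.mem_closure_iff.1 y.2 δ hδ0
  rw [dist_eq_norm] at hxy
  obtain ⟨n, hxn⟩ := hSF x hxS
  obtain ⟨m, hm⟩ := hsplit n
  have hxm : ∀ v ∈ (E m).topologicalClosure, ‖x + v‖ ^ p ≤ ‖x‖ ^ p + ‖v‖ ^ p := by
    intro v hv
    have hcl : IsClosed { v : L | ‖x + v‖ ^ p ≤ ‖x‖ ^ p + ‖v‖ ^ p } := by
      refine isClosed_le ?_ ?_
      · exact (continuous_const.add continuous_id).norm.rpow_const fun _ => Or.inr hp0.le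
      · exact continuous_const.add (continuous_norm.rpow_const fun _ => Or.inr hp0.le)
    exact closure_minimal (fun v hv => hm x hxn v hv) hcl hv
  refine ⟨(E m).topologicalClosure.comap S.topologicalClosure.subtype,
    (E m).isClosed_topologicalClosure.preimage continuous_subtype_val, ?_, fun v hv hv1 => ?_⟩
  · have hle : S.topologicalClosure ≤ (E m).topologicalClosure ⊔ F m := by
      refine S.topologicalClosure_minimal ((hsup m).trans ?_)
        (Submodule.isClosed_sup_finiteDimensional _ _ (E m).isClosed_topologicalClosure)
      rw [sup_comm]
      exact sup_le_sup_right (E m).le_topologicalClosure _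
    have hFU : F m ≤ S.topologicalClosure := (hFS m).trans S.le_topologicalClosure
    refine Module.Finite.of_surjective
      (((E m).topologicalClosure.comap S.topologicalClosure.subtype).mkQ ∘ₗ
        Submodule.inclusion hFU) ?_
    intro z
    obtain ⟨z, rfl⟩ := Submodule.mkQ_surjective _ z
    obtain ⟨e, he, f, hf, hef⟩ := Submodule.mem_sup.1 (hle z.2)
    refine ⟨⟨f, hf⟩, ?_⟩
    rw [LinearMap.comp_apply, ← sub_eq_zero, ← map_sub, Submodule.mkQ_apply,
      Submodule.Quotient.mk_eq_zero, Submodule.mem_comap]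
    have : S.topologicalClosure.subtype (Submodule.inclusion hFU ⟨f, hf⟩ - z) = -e := by
      simp [← hef]
    rw [this]
    exact neg_mem he
  · have hx1 : ‖x‖ ≤ 1 + δ := by
      have : ‖x‖ ≤ ‖(y : L)‖ + ‖(y : L) - x‖ := by
        rw [← norm_neg ((y : L) - x)]
        simpa using norm_add_le (y : L) (-((y : L) - x))
      have hy' : ‖(y : L)‖ ≤ 1 := hy
      linarith
    have hv' : (τ • (v : L)) ∈ (E m).topologicalClosure := Submodule.smul_mem _ _ hv
    have hvn : ‖τ • (v : L)‖ ≤ τ := by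
      rw [norm_smul, Real.norm_of_nonneg hτ]
      have : ‖(v : L)‖ ≤ 1 := hv1
      nlinarith
    have h1 : ‖x + τ • (v : L)‖ ≤ (1 + δ) * (1 + τ ^ p) := by
      refine (Real.rpow_le_rpow_iff (norm_nonneg _) (by positivity) hp0).1 ?_
      have h2 : ‖x‖ ^ p ≤ (1 + δ) ^ p := by gcongr
      have h3 : ‖τ • (v : L)‖ ^ p ≤ τ ^ p := by gcongr
      have h4 : 1 ≤ (1 + δ) ^ p := Real.one_le_rpow (by linarith) hp0.le
      have h5 : 1 + τ ^ p ≤ (1 + τ ^ p) ^ p := Real.self_le_rpow_of_one_le (by linarith) hp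
      rw [Real.mul_rpow (by positivity) (by positivity)]
      nlinarith [hxm _ hv']
    have h6 : ‖y + τ • v‖ ≤ ‖x + τ • (v : L)‖ + ‖(y : L) - x‖ := by
      have : ((y + τ • v : S.topologicalClosure) : L) = (x + τ • (v : L)) + ((y : L) - x) := by
        push_cast; abel
      change ‖((y + τ • v : S.topologicalClosure) : L)‖ ≤ _
      rw [this]
      exact norm_add_le _ _
    have h7 : δ * (2 + τ ^ p) = η := div_mul_cancel₀ _ (by positivity)
    linarith

theorem separableSpace_closure_span {ι : Type*} [Countable ι] (d : ι → L) :
    TopologicalSpace.SeparableSpace (Submodule.span ℝ (range d)).topologicalClosure :=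
  ((countable_range d).isSeparable.span (R := ℝ)).closure.separableSpace

/-- Hölder estimate for a quantity controlled by two weighted terms. -/
theorem add_rpow_le_of_conj {p q : ℝ} (hpq : p.HolderConjugate q) {A B x y N : ℝ}
    (hA : 0 ≤ A) (hB : 0 ≤ B) (hAB : A ^ q + B ^ q ≤ 1) (hx : 0 ≤ x) (hy : 0 ≤ y)
    (hN : N ≤ A * x + B * y) : N ≤ (x ^ p + y ^ p) ^ (1 / p) := by
  refine hN.trans ?_
  have h := Real.inner_le_Lp_mul_Lq_of_nonneg (Finset.univ : Finset (Fin 2)) hpq.symm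
    (f := ![A, B]) (g := ![x, y])
    (by intro i _; fin_cases i <;> simpa) (by intro i _; fin_cases i <;> simpa)
  simp only [Fin.sum_univ_two, Matrix.cons_val_zero, Matrix.cons_val_one] at h
  refine h.trans ?_
  have h1 : (A ^ q + B ^ q) ^ (1 / q) ≤ 1 :=
    Real.rpow_le_one (by positivity) hAB (one_div_nonneg.2 hpq.symm.nonneg)
  exact mul_le_of_le_one_left (by positivity) h1

end Closure

section Sup

variable {K : Type*}

/-- Bounded real functions on `K` with the supremum norm. -/
abbrev EllInf (K : Type*) := lp (fun _ : K => ℝ) ⊤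

/-- A bounded function, as an element of `EllInf K`. -/
noncomputable def EllInf.ofLe {B : ℝ} (f : K → ℝ) (hf : ∀ k, |f k| ≤ B) : EllInf K :=
  ⟨f, memℓp_infty ⟨B, by rintro _ ⟨k, rfl⟩; exact hf k⟩⟩

theorem EllInf.ofLe_apply {B : ℝ} (f : K → ℝ) (hf : ∀ k, |f k| ≤ B) (k : K) :
    EllInf.ofLe f hf k = f k := rfl

theorem EllInf.abs_apply_le (x : EllInf K) (k : K) : |x k| ≤ ‖x‖ :=
  lp.norm_apply_le_norm ENNReal.top_ne_zero x k

theorem EllInf.norm_le {x : EllInf K} {B : ℝ} (hB : 0 ≤ B) (h : ∀ k, |x k| ≤ B) : ‖x‖ ≤ B :=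
  lp.norm_le_of_forall_le hB h

theorem EllInf.apply_eq_of_mem_span {s : Set (EllInf K)} {a : ℝ} {k l : K}
    (h : ∀ x ∈ s, x k = a * x l) {x : EllInf K} (hx : x ∈ Submodule.span ℝ s) :
    x k = a * x l := by
  induction hx using Submodule.span_induction with
  | mem x hx => exact h x hx
  | zero => simp
  | add x y _ _ hx hy => simp only [lp.coeFn_add, Pi.add_apply, hx, hy]; ring
  | smul c x _ hx => simp only [lp.coeFn_smul, Pi.smul_apply, smul_eq_mul, hx]; ring

theorem EllInf.norm_add_rpow_le {p q : ℝ} (hpq : p.HolderConjugate q) {s t : Set (EllInf K)}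
    (h : ∀ k, ∃ (l m : K) (A B : ℝ), 0 ≤ A ∧ 0 ≤ B ∧ A ^ q + B ^ q ≤ 1 ∧
      (∀ x ∈ s, x k = A * x l) ∧ ∀ y ∈ t, y k = B * y m) {x y : EllInf K}
    (hx : x ∈ Submodule.span ℝ s) (hy : y ∈ Submodule.span ℝ t) :
    ‖x + y‖ ^ p ≤ ‖x‖ ^ p + ‖y‖ ^ p := by
  have hp := hpq.pos
  have key : ‖x + y‖ ≤ (‖x‖ ^ p + ‖y‖ ^ p) ^ (1 / p) := by
    refine EllInf.norm_le (by positivity) fun k => ?_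
    obtain ⟨l, m, A, B, hA, hB, hAB, hs, ht⟩ := h k
    refine add_rpow_le_of_conj hpq hA hB hAB (norm_nonneg x) (norm_nonneg y) ?_
    rw [lp.coeFn_add, Pi.add_apply, EllInf.apply_eq_of_mem_span hs hx,
      EllInf.apply_eq_of_mem_span ht hy]
    refine (abs_add_le _ _).trans ?_
    rw [abs_mul, abs_mul, abs_of_nonneg hA, abs_of_nonneg hB]
    gcongr
    · exact EllInf.abs_apply_le x l
    · exact EllInf.abs_apply_le y m
  have := Real.rpow_le_rpow (norm_nonneg _) key hp.le
  rwa [← Real.rpow_mul (by positivity), one_div_mul_cancel hp.ne', Real.rpow_one] at this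

/-- The span of a countable family in `EllInf K` is asymptotically uniformly smooth when the
coordinates split along an exhaustion of the family. -/
theorem ausWith_one_of_split {p q : ℝ} (hpq : p.HolderConjugate q) {ι : Type*}
    (d : ι → EllInf K) (s t : ℕ → Set (EllInf K)) (hfin : ∀ n, (s n).Finite)
    (hsub : ∀ n, s n ⊆ Submodule.span ℝ (range d)) (hmono : Monotone s)
    (hmem : ∀ i, ∃ n, d i ∈ s n)
    (hst : ∀ n i, d i ∈ Submodule.span ℝ (s n) ⊔ Submodule.span ℝ (t n))
    (h : ∀ n, ∃ n', ∀ k, ∃ (l m : K) (A B : ℝ), 0 ≤ A ∧ 0 ≤ B ∧ A ^ q + B ^ q ≤ 1 ∧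
      (∀ x ∈ s n, x k = A * x l) ∧ ∀ y ∈ t n', y k = B * y m) :
    AUSWith 1 p (Submodule.span ℝ (range d)).topologicalClosure := by
  refine ausWith_one_topologicalClosure hpq.lt.le (F := fun n => Submodule.span ℝ (s n))
    (E := fun n => Submodule.span ℝ (t n)) (fun n => ?_) (fun n => Submodule.span_le.2 (hsub n))
    (fun x hx => ?_) (fun n => ?_) (fun n => ?_)
  · exact FiniteDimensional.span_of_finite ℝ (hfin n)
  · induction hx using Submodule.span_induction with
    | mem x hx =>
      obtain ⟨i, rfl⟩ := hx
      obtain ⟨n, hn⟩ := hmem i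
      exact ⟨n, Submodule.subset_span hn⟩
    | zero => exact ⟨0, zero_mem _⟩
    | add x y _ _ hx hy =>
      obtain ⟨n, hn⟩ := hx
      obtain ⟨m, hm⟩ := hy
      exact ⟨max n m, add_mem (Submodule.span_mono (hmono (le_max_left _ _)) hn)
        (Submodule.span_mono (hmono (le_max_right _ _)) hm)⟩
    | smul c x _ hx =>
      obtain ⟨n, hn⟩ := hx
      exact ⟨n, Submodule.smul_mem _ _ hn⟩
  · rw [Submodule.span_le]
    rintro _ ⟨i, rfl⟩
    exact hst n i
  · obtain ⟨n', hn'⟩ := h n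
    exact ⟨n', fun x hx y hy => EllInf.norm_add_rpow_le hpq hn' hx hy⟩

end Sup

section ListTree

variable {α : Type*} (θ : α → ℝ) (q : ℝ)

/-- The weight of a branch segment. -/
noncomputable def segWeight (l : List α) : ℝ := (l.map θ).sum ^ (1 / q)

variable {θ q}

theorem sum_map_nonneg (hθ : ∀ a, 0 < θ a) (l : List α) : 0 ≤ (l.map θ).sum :=
  List.sum_nonneg (by simpa using fun a _ => (hθ a).le)

theorem segWeight_nonneg (hθ : ∀ a, 0 < θ a) (l : List α) : 0 ≤ segWeight θ q l :=
  Real.rpow_nonneg (sum_map_nonneg hθ l) _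

theorem segWeight_rpow (hθ : ∀ a, 0 < θ a) (hq : 0 < q) (l : List α) :
    segWeight θ q l ^ q = (l.map θ).sum := by
  rw [segWeight, one_div, Real.rpow_inv_rpow (sum_map_nonneg hθ l) hq.ne']

theorem segWeight_append_rpow (hθ : ∀ a, 0 < θ a) (hq : 0 < q) (l r : List α) :
    segWeight θ q (l ++ r) ^ q = segWeight θ q l ^ q + segWeight θ q r ^ q := by
  simp [segWeight_rpow hθ hq]

theorem segWeight_pos (hθ : ∀ a, 0 < θ a) {l : List α} (hl : l ≠ []) : 0 < segWeight θ q l := by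
  obtain ⟨a, l, rfl⟩ := List.exists_cons_of_ne_nil hl
  have := sum_map_nonneg hθ l
  have := hθ a
  refine Real.rpow_pos_of_pos ?_ _
  simp only [List.map_cons, List.sum_cons]
  linarith

theorem segWeight_le_append (hθ : ∀ a, 0 < θ a) (hq : 0 < q) (l r : List α) :
    segWeight θ q l ≤ segWeight θ q (l ++ r) := by
  refine Real.rpow_le_rpow (sum_map_nonneg hθ l) ?_ (one_div_nonneg.2 hq.le)
  have := sum_map_nonneg hθ r
  simp only [List.map_append, List.sum_append]
  linarith

theorem rpow_le_segWeight_of_mem (hθ : ∀ a, 0 < θ a) (hq : 0 < q) {l : List α} {a : α}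
    (ha : a ∈ l) : θ a ^ (1 / q) ≤ segWeight θ q l := by
  refine Real.rpow_le_rpow (hθ a).le ?_ (one_div_nonneg.2 hq.le)
  exact List.single_le_sum (by simpa using fun a _ => (hθ a).le) _ (List.mem_map_of_mem ha)

theorem List.head_mem_of_suffix_append {a : α} {s l r : List α} (h : a :: s <:+ l ++ r)
    (h' : ¬ a :: s <:+ r) : a ∈ l := by
  induction l with
  | nil => exact absurd h h'
  | cons b l ih =>
    rw [List.cons_append, List.suffix_cons_iff] at h
    rcases h with h | h
    · rw [List.cons.injEq] at h
      simp [h.1]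
    · exact List.mem_cons_of_mem _ (ih h)

open Classical in
/-- The increment along `l ++ r` past `r` of the indicator of the descendants of `s`. -/
noncomputable def passes (s l r : List α) : ℝ :=
  (if s <:+ l ++ r then 1 else 0) - if s <:+ r then 1 else 0

theorem passes_nil (s r : List α) : passes s [] r = 0 := by simp [passes]

theorem abs_passes_div_le (hθ : ∀ a, 0 < θ a) (hq : 0 < q) (s : List α)
    (k : List α × List α) :
    |passes s k.1 k.2 / segWeight θ q k.1| ≤ ((s.head?.map θ).getD 1 ^ (1 / q))⁻¹ := by
  obtain ⟨l, r⟩ := k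
  cases s with
  | nil => simp [passes]
  | cons a s =>
    have hθa : 0 < θ a ^ (1 / q) := Real.rpow_pos_of_pos (hθ a) _
    by_cases h1 : a :: s <:+ r
    · have : a :: s <:+ l ++ r := h1.trans (List.suffix_append l r)
      simp [passes, h1, this, (hθ a).le, Real.rpow_nonneg]
    by_cases h2 : a :: s <:+ l ++ r
    · have h3 := rpow_le_segWeight_of_mem hθ hq (List.head_mem_of_suffix_append h2 h1)
      have h4 : 0 < segWeight θ q l := hθa.trans_le h3
      simp only [passes, h2, h1, if_true, if_false, sub_zero, List.head?_cons, Option.map_some,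
        Option.getD_some, one_div]
      rw [one_div] at h3 hθa
      rw [abs_of_pos (inv_pos.2 h4)]
      exact inv_anti₀ hθa h3
    · simp [passes, h1, h2, (hθ a).le, Real.rpow_nonneg]

/-- The element of `EllInf` attached to the node `s`. -/
noncomputable def nodeVec (hθ : ∀ a, 0 < θ a) (hq : 0 < q) (s : List α) :
    EllInf (List α × List α) :=
  EllInf.ofLe (fun k => passes s k.1 k.2 / segWeight θ q k.1) (abs_passes_div_le hθ hq s)

theorem nodeVec_apply (hθ : ∀ a, 0 < θ a) (hq : 0 < q) (s : List α) (k : List α × List α) :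
    nodeVec hθ hq s k = passes s k.1 k.2 / segWeight θ q k.1 := rfl

theorem encode_le_of_suffix [Encodable α] {s t : List α} (h : s <:+ t) :
    Encodable.encode s ≤ Encodable.encode t := by
  induction t with
  | nil => rw [List.suffix_nil.1 h]
  | cons a t ih =>
    rcases List.suffix_cons_iff.1 h with rfl | h
    · exact le_rfl
    · refine (ih h).trans ?_
      rw [Encodable.encode_list_cons]
      exact (Nat.right_le_pair _ _).trans (Nat.le_succ _)

theorem exists_split [Encodable α] (n : ℕ) (l r : List α) :
    ∃ l₂ l₁, l = l₂ ++ l₁ ∧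
      (∀ s, Encodable.encode s < n → (s <:+ l ++ r ↔ s <:+ l₁ ++ r)) ∧
      ∀ s, n ≤ Encodable.encode s → (s <:+ l₁ ++ r ↔ s <:+ r) := by
  induction l with
  | nil => exact ⟨[], [], rfl, fun _ _ => Iff.rfl, fun _ _ => Iff.rfl⟩
  | cons b l ih =>
    obtain ⟨l₂, l₁, h, h1, h2⟩ := ih
    rcases lt_or_ge (Encodable.encode (b :: (l ++ r))) n with hlt | hge
    · refine ⟨[], b :: l, rfl, fun _ _ => Iff.rfl, fun s hs => ?_⟩
      have : ¬ s <:+ b :: (l ++ r) := fun hs' => by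
        have := encode_le_of_suffix hs'
        omega
      exact ⟨fun hs' => absurd hs' this,
        fun hs' => absurd (hs'.trans (List.suffix_append (b :: l) r)) this⟩
    · refine ⟨b :: l₂, l₁, by rw [h, List.cons_append], fun s hs => ?_, h2⟩
      rw [← h1 s hs, List.cons_append, List.suffix_cons_iff]
      exact ⟨fun hs' => hs'.resolve_left (by rintro rfl; omega), Or.inr⟩

theorem ausWith_nodeVec [Encodable α] {p : ℝ} (hpq : p.HolderConjugate q) (hθ : ∀ a, 0 < θ a) :
    AUSWith 1 p
      (Submodule.span ℝ (range (nodeVec hθ hpq.symm.pos))).topologicalClosure := by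
  have hq := hpq.symm.pos
  refine ausWith_one_of_split hpq _ (fun n => nodeVec hθ hq '' {s | Encodable.encode s < n})
    (fun n => nodeVec hθ hq '' {s | n ≤ Encodable.encode s}) (fun n => ?_) (fun n => ?_)
    (fun m n hmn => ?_) (fun s => ?_) (fun n s => ?_) (fun n => ⟨n, fun k => ?_⟩)
  · exact ((finite_Iio n).preimage Encodable.encode_injective.injOn).image _
  · exact (image_subset_range _ _).trans Submodule.subset_span
  · exact image_mono fun s (hs : _ < m) => hs.trans_le hmn
  · exact ⟨Encodable.encode s + 1, mem_image_of_mem _ (Nat.lt_succ_self _)⟩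
  · rcases lt_or_ge (Encodable.encode s) n with h | h
    · exact Submodule.mem_sup_left (Submodule.subset_span (mem_image_of_mem _ h))
    · exact Submodule.mem_sup_right (Submodule.subset_span (mem_image_of_mem _ h))
  · obtain ⟨l, r⟩ := k
    obtain ⟨l₂, l₁, rfl, h1, h2⟩ := exists_split n l r
    have hw := segWeight_append_rpow hθ hq l₂ l₁
    have hn := segWeight_nonneg (q := q) hθ
    refine ⟨(l₁, r), (l₂, l₁ ++ r), segWeight θ q l₁ / segWeight θ q (l₂ ++ l₁),
      segWeight θ q l₂ / segWeight θ q (l₂ ++ l₁), div_nonneg (hn _) (hn _),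
      div_nonneg (hn _) (hn _), ?_, ?_, ?_⟩
    · rw [Real.div_rpow (hn _) (hn _), Real.div_rpow (hn _) (hn _), ← add_div, hw, add_comm]
      exact div_self_le_one _
    · rintro _ ⟨s, hs, rfl⟩
      have : passes s (l₂ ++ l₁) r = passes s l₁ r := by
        unfold passes
        congr 1
        by_cases h : s <:+ l₁ ++ r
        · rw [if_pos h, if_pos ((h1 s hs).2 h)]
        · rw [if_neg h, if_neg (mt (h1 s hs).1 h)]
      simp only [nodeVec_apply, this]
      rcases eq_or_ne l₁ [] with rfl | hl
      · simp [passes_nil]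
      · field_simp [(segWeight_pos (q := q) hθ hl).ne']
    · rintro _ ⟨s, hs, rfl⟩
      have : passes s (l₂ ++ l₁) r = passes s l₂ (l₁ ++ r) := by
        unfold passes
        congr 1
        · rw [List.append_assoc]
        by_cases h : s <:+ r
        · rw [if_pos h, if_pos ((h2 s hs).2 h)]
        · rw [if_neg h, if_neg (mt (h2 s hs).1 h)]
      simp only [nodeVec_apply, this]
      rcases eq_or_ne l₂ [] with rfl | hl
      · simp [passes_nil]
      · field_simp [(segWeight_pos (q := q) hθ hl).ne']

end ListTree

section FunctionalTree

variable {α : Type*} {θ : α → ℝ} {q : ℝ} {X : Type*} [NormedAddCommGroup X] [NormedSpace ℝ X]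

/-- The ancestor of `t` at level `m` (or `t` itself if its level is smaller). -/
def truncate (m : ℕ) (t : List α) : List α := t.drop (t.length - m)

theorem truncate_of_length_le {m : ℕ} {t : List α} (h : t.length ≤ m) : truncate m t = t := by
  simp [truncate, Nat.sub_eq_zero_of_le h]

theorem truncate_cons {m : ℕ} {t : List α} (b : α) (h : m ≤ t.length) :
    truncate m (b :: t) = truncate m t := by
  rw [truncate, List.length_cons, Nat.sub_add_comm h, List.drop_succ_cons, truncate]

theorem truncate_append {m : ℕ} {r : List α} (l : List α) (h : m ≤ r.length) :
    truncate m (l ++ r) = truncate m r := by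
  induction l with
  | nil => rfl
  | cons b l ih =>
    rw [List.cons_append, truncate_cons _ (by simp only [List.length_append]; omega), ih]

theorem exists_truncate_append {m : ℕ} {r : List α} (l : List α) (h : r.length ≤ m) :
    ∃ l₂ l₁, l = l₂ ++ l₁ ∧ truncate m (l ++ r) = l₁ ++ r ∧ (l₂ = [] ∨ m ≤ (l₁ ++ r).length) := by
  induction l with
  | nil => exact ⟨[], [], rfl, truncate_of_length_le h, Or.inl rfl⟩
  | cons b l ih =>
    rcases Nat.lt_or_ge m (l ++ r).length.succ with hm | hm
    · obtain ⟨l₂, l₁, rfl, ht, h'⟩ := ih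
      refine ⟨b :: l₂, l₁, rfl, ?_, Or.inr ?_⟩
      · rw [List.cons_append, truncate_cons _ (by omega), ht]
      · rcases h' with rfl | h'
        · rw [List.nil_append] at hm
          omega
        · exact h'
    · exact ⟨[], b :: l, rfl, truncate_of_length_le hm, Or.inl rfl⟩

open Classical in
theorem sum_mul_descendant (m : ℕ) (φ : List α → ℝ) (A : Finset (List α))
    (hA : ∀ s, s ∈ A ↔ s.length ≤ m ∧ φ s ≠ φ s.tail) (t : List α) :
    ∑ s ∈ A, (φ s - φ s.tail) * (if s <:+ t then 1 else 0) = φ (truncate m t) - φ [] := by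
  induction t with
  | nil =>
    rw [truncate_of_length_le (Nat.zero_le _), sub_self]
    refine Finset.sum_eq_zero fun s _ => ?_
    rcases eq_or_ne s [] with rfl | hs
    · simp
    · simp [hs]
  | cons b t ih =>
    have h1 : ∀ s : List α, (if s <:+ b :: t then (1 : ℝ) else 0)
        = (if s <:+ t then 1 else 0) + if s = b :: t then 1 else 0 := by
      intro s
      by_cases hs : s = b :: t
      · subst hs
        have : ¬ b :: t <:+ t := fun h => by simpa using h.length_le
        simp [this]
      · simp [hs, List.suffix_cons_iff]
    simp only [h1, mul_add, Finset.sum_add_distrib]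
    rw [ih]
    simp only [mul_ite, mul_one, mul_zero,
      Finset.sum_ite_eq']
    rcases Nat.lt_or_ge t.length m with hm | hm
    · rw [truncate_of_length_le hm.le, truncate_of_length_le (by simpa using hm)]
      split_ifs with hb
      · simp
      · have : φ (b :: t) = φ t := by
          by_contra hne
          exact hb ((hA _).2 ⟨by simpa using hm, hne⟩)
        rw [this]; ring
    · rw [truncate_cons _ hm, if_neg]
      · simp
      · rw [hA]
        simp only [List.length_cons]
        omega

/-- A tree of functionals witnessing that `X` embeds into the list tree space. -/
structure IsFunctionalTree (θ : α → ℝ) (q c B : ℝ) (x : ℕ → X) (g : List α → StrongDual ℝ X) :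
    Prop where
  nil : g [] = 0
  segment : ∀ l r, ‖g (l ++ r) - g r‖ ≤ c * segWeight θ q l
  tail : ∀ j, ∀ η : ℝ, 0 < η → ∃ m, ∀ r : List α, m ≤ r.length → ∀ l,
    |(g (l ++ r) - g r) (x j)| ≤ η * segWeight θ q l
  finite : ∀ m, {s : List α | s.length ≤ m ∧ g s ≠ g s.tail}.Finite
  follow : ∀ f : StrongDual ℝ X, ‖f‖ ≤ 1 → ∀ j, ∀ η : ℝ, 0 < η →
    ∃ t, segWeight θ q t ≤ B ∧ |g t (x j) - f (x j)| ≤ η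

namespace IsFunctionalTree

variable {c B : ℝ} {x : ℕ → X} {g : List α → StrongDual ℝ X}

theorem abs_apply_div_le (hg : IsFunctionalTree θ q c B x g) (hθ : ∀ a, 0 < θ a)
    (hc : 0 ≤ c) (v : X) (k : List α × List α) :
    |(g (k.1 ++ k.2) - g k.2) v / segWeight θ q k.1| ≤ c * ‖v‖ := by
  have hw := segWeight_nonneg (q := q) hθ k.1
  rw [abs_div, abs_of_nonneg hw]
  refine div_le_of_le_mul₀ hw (by positivity) ?_
  refine ((g (k.1 ++ k.2) - g k.2).le_opNorm v).trans ?_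
  have := mul_le_mul_of_nonneg_right (hg.segment k.1 k.2) (norm_nonneg v)
  linarith

/-- The evaluation operator of a functional tree. -/
noncomputable def toEllInf (hg : IsFunctionalTree θ q c B x g) (hθ : ∀ a, 0 < θ a)
    (hc : 0 ≤ c) : X →L[ℝ] EllInf (List α × List α) :=
  LinearMap.mkContinuous
    { toFun := fun v => EllInf.ofLe _ (hg.abs_apply_div_le hθ hc v)
      map_add' := fun v w => by
        ext k
        simp only [EllInf.ofLe_apply, lp.coeFn_add, Pi.add_apply, map_add, add_div]
      map_smul' := fun a v => by
        ext k
        simp only [EllInf.ofLe_apply, lp.coeFn_smul, Pi.smul_apply, map_smul, smul_eq_mul,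
          RingHom.id_apply, mul_div_assoc] }
    c fun v => EllInf.norm_le (by positivity) (hg.abs_apply_div_le hθ hc v)

theorem toEllInf_apply (hg : IsFunctionalTree θ q c B x g) (hθ : ∀ a, 0 < θ a)
    (hc : 0 ≤ c) (v : X) (k : List α × List α) :
    hg.toEllInf hθ hc v k = (g (k.1 ++ k.2) - g k.2) v / segWeight θ q k.1 := rfl

theorem _root_.apply_truncate_sub_le (hθ : ∀ a, 0 < θ a)
    (hq : 0 < q) {j m : ℕ} {η : ℝ} (hη : 0 ≤ η)
    (hm : ∀ r : List α, m ≤ r.length → ∀ l, |(g (l ++ r) - g r) (x j)| ≤ η * segWeight θ q l)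
    (l r : List α) :
    |(g (l ++ r) - g r) (x j) - (g (truncate m (l ++ r)) - g (truncate m r)) (x j)|
      ≤ η * segWeight θ q l := by
  rcases le_total m r.length with h | h
  · rw [truncate_append l h]
    simpa using hm r h l
  · obtain ⟨l₂, l₁, rfl, ht, h'⟩ := exists_truncate_append l h
    rw [ht, truncate_of_length_le h]
    have he : (g (l₂ ++ l₁ ++ r) - g r) (x j) - (g (l₁ ++ r) - g r) (x j)
        = (g (l₂ ++ (l₁ ++ r)) - g (l₁ ++ r)) (x j) := by
      simp [List.append_assoc]
    rw [he]
    rcases h' with rfl | h'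
    · simpa using mul_nonneg hη (segWeight_nonneg hθ _)
    · refine (hm _ h' l₂).trans ?_
      gcongr
      exact segWeight_le_append hθ hq _ _

open Classical in
theorem toEllInf_mem (hg : IsFunctionalTree θ q c B x g) (hθ : ∀ a, 0 < θ a) (hc : 0 ≤ c)
    (hq : 0 < q) (j : ℕ) :
    hg.toEllInf hθ hc (x j) ∈ (Submodule.span ℝ (range (nodeVec hθ hq))).topologicalClosure := by
  refine Metric.mem_closure_iff.2 fun ε hε => ?_
  obtain ⟨m, hm⟩ := hg.tail j (ε / 2) (half_pos hε)
  have hfin : {s : List α | s.length ≤ m ∧ g s (x j) ≠ g s.tail (x j)}.Finite :=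
    (hg.finite m).subset fun s hs => ⟨hs.1, fun h => hs.2 (by rw [h])⟩
  refine ⟨∑ s ∈ hfin.toFinset, (g s (x j) - g s.tail (x j)) • nodeVec hθ hq s,
    Submodule.sum_mem _ fun s _ => Submodule.smul_mem _ _ (Submodule.subset_span ⟨s, rfl⟩), ?_⟩
  rw [dist_eq_norm]
  refine lt_of_le_of_lt (EllInf.norm_le (half_pos hε).le fun k => ?_) (half_lt_self hε)
  obtain ⟨l, r⟩ := k
  have hw := segWeight_nonneg (q := q) hθ l
  have hsum : (∑ s ∈ hfin.toFinset, (g s (x j) - g s.tail (x j)) • nodeVec hθ hq s) (l, r)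
      = (g (truncate m (l ++ r)) - g (truncate m r)) (x j) / segWeight θ q l := by
    have h1 := sum_mul_descendant m (fun s => g s (x j)) hfin.toFinset (by simp)
    rw [lp.coeFn_sum, Finset.sum_apply, sub_apply,
      ← sub_sub_sub_cancel_right _ _ (g [] (x j)), ← h1, ← h1, ← Finset.sum_sub_distrib,
      Finset.sum_div]
    refine Finset.sum_congr rfl fun s _ => ?_
    simp only [lp.coeFn_smul, Pi.smul_apply, nodeVec_apply, smul_eq_mul, passes]
    ring
  rw [lp.coeFn_sub, Pi.sub_apply, hsum, toEllInf_apply, ← sub_div, abs_div, abs_of_nonneg hw]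
  exact div_le_of_le_mul₀ hw (half_pos hε).le (apply_truncate_sub_le hθ hq (half_pos hε).le hm l r)

theorem norm_le_toEllInf (hg : IsFunctionalTree θ q c B x g) (hθ : ∀ a, 0 < θ a) (hc : 0 ≤ c)
    (j : ℕ) : ‖x j‖ ≤ B * ‖hg.toEllInf hθ hc (x j)‖ := by
  obtain ⟨f, hf, hfx⟩ := exists_dual_vector'' ℝ (x j)
  replace hfx : f (x j) = ‖x j‖ := hfx
  refine le_of_forall_pos_le_add fun η hη => ?_
  obtain ⟨t, ht, htf⟩ := hg.follow f hf j η hη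
  have h1 := EllInf.abs_apply_le (hg.toEllInf hθ hc (x j)) (t, [])
  rw [toEllInf_apply, hg.nil, sub_zero, List.append_nil] at h1
  have hw := segWeight_nonneg (q := q) hθ t
  have h2 : |g t (x j)| ≤ segWeight θ q t * ‖hg.toEllInf hθ hc (x j)‖ := by
    rcases eq_or_ne t [] with rfl | hne
    · rw [hg.nil]
      simpa using mul_nonneg hw (norm_nonneg _)
    · have hpos := segWeight_pos (q := q) hθ hne
      rwa [abs_div, abs_of_pos hpos, div_le_iff₀ hpos, mul_comm] at h1
  have h3 : segWeight θ q t * ‖hg.toEllInf hθ hc (x j)‖ ≤ B * ‖hg.toEllInf hθ hc (x j)‖ := by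
    gcongr
  have h4 := abs_le.1 htf
  have h5 := le_abs_self (g t (x j))
  rw [hfx] at h4
  linarith [h4.1]

theorem isomToClosedSubspace (hg : IsFunctionalTree θ q c B x g) (hθ : ∀ a, 0 < θ a)
    (hc : 0 ≤ c) (hB : 0 < B) (hq : 0 < q) (hx : DenseRange x) :
    IsomToClosedSubspace X (Submodule.span ℝ (range (nodeVec hθ hq))).topologicalClosure := by
  have hmem : ∀ v, hg.toEllInf hθ hc v ∈
      (Submodule.span ℝ (range (nodeVec hθ hq))).topologicalClosure := fun v =>
    hx.induction_on v ((Submodule.isClosed_topologicalClosure _).preimage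
      (hg.toEllInf hθ hc).continuous) (hg.toEllInf_mem hθ hc hq)
  have hlow : ∀ v, ‖v‖ ≤ B * ‖hg.toEllInf hθ hc v‖ := fun v =>
    hx.induction_on v (isClosed_le continuous_norm
      (continuous_const.mul (hg.toEllInf hθ hc).continuous.norm))
      (hg.norm_le_toEllInf hθ hc)
  refine ⟨(hg.toEllInf hθ hc).codRestrict _ hmem, ?_, B⁻¹, inv_pos.2 hB, fun v => ?_⟩
  · refine (injective_iff_map_eq_zero _).2 fun v hv => ?_
    have h0 : hg.toEllInf hθ hc v = 0 := congrArg Subtype.val hv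
    have := hlow v
    rw [h0, norm_zero, mul_zero] at this
    exact norm_le_zero_iff.1 this
  · rw [inv_mul_le_iff₀ hB]
    exact hlow v

end IsFunctionalTree

end FunctionalTree

section Stability

variable {X : Type*} [NormedAddCommGroup X] [NormedSpace ℝ X] {C p q : ℝ}

theorem exists_mul_rpow_le (hp : 1 < p) (hC : 1 ≤ C) :
    ∃ κ : ℝ, 0 < κ ∧ κ ≤ 1 ∧ C * κ ^ p ≤ κ := by
  have hC0 : 0 < C := by linarith
  have hp' : 0 < p - 1 := by linarith
  refine ⟨C⁻¹ ^ (1 / (p - 1)), by positivity,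
    Real.rpow_le_one (by positivity) (inv_le_one_of_one_le₀ hC) (by positivity), le_of_eq ?_⟩
  set κ := C⁻¹ ^ (1 / (p - 1)) with hκ
  have hκ0 : 0 < κ := by positivity
  have h1 : κ ^ (p - 1) = C⁻¹ := by
    rw [hκ, one_div, Real.rpow_inv_rpow (by positivity) hp'.ne']
  have h2 : κ ^ p = κ ^ (p - 1) * κ := by
    rw [← Real.rpow_add_one hκ0.ne', sub_add_cancel]
  rw [h2, h1]
  field_simp

theorem rpow_le_of_le_three_mul (hq : 1 ≤ q) {b ν η : ℝ} (hν : 0 ≤ ν) (hη : 0 ≤ η) (hη1 : η ≤ 1)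
    (hb : 0 ≤ b) (h : ν ≤ 3 * b + 4 * η) : ν ^ q ≤ 7 ^ q * (b ^ q + η) := by
  have hq0 : 0 < q := by linarith
  have h7 : (0 : ℝ) < 7 ^ q := by positivity
  rcases le_total η b with hηb | hηb
  · have : ν ^ q ≤ (7 * b) ^ q := by gcongr; linarith
    rw [Real.mul_rpow (by norm_num) hb] at this
    nlinarith
  · have h1 : ν ^ q ≤ (7 * η) ^ q := by gcongr; linarith
    rw [Real.mul_rpow (by norm_num) hη] at h1
    have h2 : η ^ q ≤ η := Real.rpow_le_self_of_le_one hη hη1 hq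
    have h3 : 0 ≤ b ^ q := by positivity
    nlinarith

/-- Weak-star lower stability of the dual norm, with `q`-power gain. -/
theorem SharpAUS.exists_dual_stability (hpq : p.HolderConjugate q) (hC : 1 ≤ C)
    (h : SharpAUS C p X) : ∃ c : ℝ, 0 < c ∧ c ≤ 1 ∧ ∀ g : StrongDual ℝ X, ‖g‖ ≤ 1 → ∀ ε : ℝ, 0 < ε →
      ∃ u : Set X, u.Finite ∧ ∃ η : ℝ, 0 < η ∧ ∀ f : StrongDual ℝ X, ‖f‖ ≤ 1 →
        (∀ v ∈ u, |(f - g) v| ≤ η) → c * ‖f - g‖ ^ q ≤ ‖f‖ ^ q - ‖g‖ ^ q + ε := by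
  have hq1 := hpq.symm.lt
  obtain ⟨κ, hκ, hκ1, hCκ⟩ := exists_mul_rpow_le hpq.lt hC
  have h7 : (1 : ℝ) ≤ 7 ^ q := Real.one_le_rpow (by norm_num) (by linarith)
  refine ⟨κ / 7 ^ q, by positivity, div_le_one_of_le₀ (hκ1.trans h7) (by positivity),
    fun g hg ε hε => ?_⟩
  set η := min 1 (ε / (3 * q + 1)) with hη
  have hη0 : 0 < η := lt_min one_pos (by positivity)
  have hη1 : η ≤ 1 := min_le_left _ _
  have hηε : (3 * q + 1) * η ≤ ε := by
    have : η ≤ ε / (3 * q + 1) := min_le_right _ _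
    rwa [le_div_iff₀ (by positivity), mul_comm] at this
  obtain ⟨y, hy, hgy⟩ : ∃ y : X, ‖y‖ ≤ 1 ∧ ‖g‖ - η ≤ g y := by
    obtain ⟨y, hy, hgy⟩ := g.exists_lt_apply_of_lt_opNorm (sub_lt_self ‖g‖ hη0)
    rw [Real.norm_eq_abs] at hgy
    rcases abs_cases (g y) with ⟨h1, -⟩ | ⟨h1, -⟩
    · exact ⟨y, hy.le, by linarith⟩
    · exact ⟨-y, by rw [norm_neg]; exact hy.le, by rw [map_neg]; linarith⟩
  obtain ⟨E, hE, hEb⟩ := h {y} (finite_singleton y).isCompact.totallyBounded (by simpa using hy)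
    η hη0
  obtain ⟨G, hGf, hGs, hG⟩ := (hE.inf (IsTail.ker g)).exists_finite_net
    (subset_refl (closedBall (0 : X) 1)) hη0
  refine ⟨insert y G, hGf.insert y, η, hη0, fun f hf hu => ?_⟩
  have hfy := (abs_le.1 (hu y (mem_insert _ _))).1
  rw [sub_apply] at hfy
  set ν := ‖f - g‖ with hν
  obtain ⟨z, hz, hfz⟩ : ∃ z : X, ‖z‖ ≤ 1 ∧ ν - η ≤ (f - g) z := by
    obtain ⟨z, hz, hfz⟩ := (f - g).exists_lt_apply_of_lt_opNorm (sub_lt_self ‖f - g‖ hη0)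
    rw [Real.norm_eq_abs] at hfz
    rcases abs_cases ((f - g) z) with ⟨h1, -⟩ | ⟨h1, -⟩
    · exact ⟨z, hz.le, by linarith⟩
    · exact ⟨-z, by rw [norm_neg]; exact hz.le, by rw [map_neg]; linarith⟩
  obtain ⟨w, hw, e, he, hze⟩ := hG z (by simpa using hz)
  have hw1 : ‖w‖ ≤ 1 := by simpa using hGs hw
  have he3 : ‖e‖ ≤ 3 := by
    have h1 : e = z - w - (z - w - e) := by abel
    rw [h1]
    refine (norm_sub_le _ _).trans ?_
    linarith [norm_sub_le z w]
  have hfe : ν - 4 * η ≤ f e := by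
    have h1 : (f - g) z = (f - g) w + f e + (f - g) (z - w - e) := by
      have : g e = 0 := he.2
      simp only [sub_apply, map_sub, this]
      ring
    have h2 : (f - g) (z - w - e) ≤ 2 * η := by
      refine (le_abs_self _).trans (((f - g).le_opNorm _).trans ?_)
      have : ‖f - g‖ ≤ 2 := by linarith [norm_sub_le f g]
      exact mul_le_mul this hze (norm_nonneg _) (by norm_num)
    have h3 := (abs_le.1 (hu w (mem_insert_of_mem _ hw))).2
    linarith
  obtain ⟨b, x, hb, hxE, hx1, hbx, hνb⟩ : ∃ (b : ℝ) (x : X), 0 ≤ b ∧ x ∈ E ∧ ‖x‖ ≤ 1 ∧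
      b ≤ f x ∧ ν ≤ 3 * b + 4 * η := by
    rcases le_total (f e) 0 with h0 | h0
    · exact ⟨0, 0, le_rfl, E.zero_mem, by simp, by simp, by linarith⟩
    · refine ⟨f e / 3, (3⁻¹ : ℝ) • e, by positivity, E.smul_mem _ he.1, ?_, ?_, by linarith⟩
      · rw [norm_smul]
        norm_num
        linarith
      · rw [map_smul, smul_eq_mul]
        linarith
  have hb1 : b ≤ 1 := by
    refine hbx.trans ((le_abs_self _).trans ((f.le_opNorm x).trans ?_))
    exact mul_le_one₀ hf (norm_nonneg _) hx1
  have hmain := rpow_add_mul_rpow_le hpq (zero_le_one.trans hC) hκ hκ1 hCκ (norm_nonneg g) hg hb hb1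
    (norm_nonneg f) (η := 3 * η) fun σ τ hσ hσ1 hτ hτ1 => by
      have h1 : f (σ • y + τ • x) ≤ ‖f‖ * ((σ ^ p + C * τ ^ p) ^ (1 / p) + η) := by
        refine (le_abs_self _).trans ((f.le_opNorm _).trans ?_)
        gcongr
        exact hEb y rfl x hxE hx1 σ τ hσ hσ1 hτ
      have h2 : σ * ‖g‖ ≤ σ * f y + 2 * η := by nlinarith
      have h3 : τ * b ≤ τ * f x := by gcongr
      rw [map_add, map_smul, map_smul, smul_eq_mul, smul_eq_mul] at h1
      nlinarith
  have h8 := rpow_le_of_le_three_mul hq1.le (norm_nonneg (f - g)) hη0.le hη1 hb hνb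
  have h9 : κ / 7 ^ q * ν ^ q ≤ κ * (b ^ q + η) := by
    rw [div_mul_eq_mul_div, div_le_iff₀ (by positivity)]
    nlinarith
  nlinarith

/-- Weak-star closedness of a set of functionals. -/
def IsWeakClosed (K : Set (StrongDual ℝ X)) : Prop :=
  IsClosed (WeakDual.toStrongDual ⁻¹' K : Set (WeakDual ℝ X))

theorem IsWeakClosed.exists_cover {K : Set (StrongDual ℝ X)} (hK : IsWeakClosed K)
    (hK1 : K ⊆ closedBall 0 1) {P : StrongDual ℝ X → StrongDual ℝ X → Prop}
    (hP : ∀ g ∈ K, ∃ u : Set X, u.Finite ∧ ∃ η : ℝ, 0 < η ∧ ∀ f : StrongDual ℝ X, ‖f‖ ≤ 1 →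
      (∀ v ∈ u, |(f - g) v| ≤ η) → P g f) :
    ∃ L : List (Set (StrongDual ℝ X) × StrongDual ℝ X),
      (∀ D ∈ L, IsWeakClosed D.1 ∧ D.1 ⊆ K ∧ D.2 ∈ D.1 ∧ ∀ f ∈ D.1, P D.2 f) ∧
      ∀ f ∈ K, ∃ D ∈ L, f ∈ D.1 := by
  choose! u hu η hη huP using hP
  have hcont : ∀ (g : StrongDual ℝ X) (v : X), Continuous fun f : WeakDual ℝ X => |f v - g v| :=
    fun g v => ((WeakDual.eval_continuous v).sub continuous_const).abs
  have hcpt : IsCompact (WeakDual.toStrongDual ⁻¹' K : Set (WeakDual ℝ X)) :=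
    (WeakDual.isCompact_closedBall (𝕜 := ℝ) (0 : StrongDual ℝ X) 1).of_isClosed_subset hK
      (preimage_mono hK1)
  obtain ⟨t, htK, ht⟩ := hcpt.elim_nhds_subcover
    (fun g => {f : WeakDual ℝ X | ∀ v ∈ u g.toStrongDual,
      |f v - g.toStrongDual v| < η g.toStrongDual}) fun g hg => by
    have : {f : WeakDual ℝ X | ∀ v ∈ u g.toStrongDual,
        |f v - g.toStrongDual v| < η g.toStrongDual} = ⋂ v ∈ u g.toStrongDual,
        {f : WeakDual ℝ X | |f v - g.toStrongDual v| < η g.toStrongDual} := by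
      ext f; simp
    rw [this]
    refine (biInter_mem (hu (WeakDual.toStrongDual g) hg)).2 fun v _ => ?_
    refine (isOpen_lt (hcont _ v) continuous_const).mem_nhds ?_
    have := hη (WeakDual.toStrongDual g) hg
    simpa using this
  refine ⟨t.toList.map fun g => (K ∩ {f | ∀ v ∈ u g.toStrongDual,
    |(f - g.toStrongDual) v| ≤ η g.toStrongDual}, g.toStrongDual), ?_, fun f hf => ?_⟩
  · intro D hD
    obtain ⟨g, hg, rfl⟩ := List.mem_map.1 hD
    have hgK : g.toStrongDual ∈ K := htK g (by simpa using hg)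
    refine ⟨?_, inter_subset_left, ⟨hgK, fun v _ => ?_⟩, fun f hf => ?_⟩
    · have : (WeakDual.toStrongDual ⁻¹' {f : StrongDual ℝ X | ∀ v ∈ u g.toStrongDual,
          |(f - g.toStrongDual) v| ≤ η g.toStrongDual} : Set (WeakDual ℝ X)) =
          ⋂ v ∈ u g.toStrongDual,
            {f : WeakDual ℝ X | |f v - g.toStrongDual v| ≤ η g.toStrongDual} := by
        ext f; simp
      have h2 := isClosed_biInter (s := u g.toStrongDual) fun v _ =>
        isClosed_le (hcont g.toStrongDual v) (continuous_const (y := η g.toStrongDual))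
      rw [← this] at h2
      exact hK.inter h2
    · simpa using (hη _ hgK).le
    · exact huP _ hgK f (by simpa using hK1 hf.1) hf.2
  · have := ht (show f.toWeakDual ∈ _ from hf)
    simp only [mem_iUnion, exists_prop] at this
    obtain ⟨g, hg, hfg⟩ := this
    exact ⟨_, List.mem_map_of_mem (by simpa using hg), hf, fun v hv => (hfg v hv).le⟩

end Stability

section DualTree

variable {X : Type*} [NormedAddCommGroup X] [NormedSpace ℝ X] {q c : ℝ} {x : ℕ → X}
  {cov : ℕ → Set (StrongDual ℝ X) → List (Set (StrongDual ℝ X) × StrongDual ℝ X)}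

/-- The precision with which the functionals at depth `k` are approximated on the first `k`
test vectors. -/
noncomputable def depthTol (q : ℝ) (k : ℕ) : ℝ := 1 / (k + 1) * ((1 / 4) ^ k / 2) ^ (1 / q)

/-- `g` is a centre at depth `k` for `f`. -/
def IsCentre (q c : ℝ) (x : ℕ → X) (k : ℕ) (g f : StrongDual ℝ X) : Prop :=
  c * ‖f - g‖ ^ q ≤ ‖f‖ ^ q - ‖g‖ ^ q + (1 / 4) ^ k ∧ ∀ j < k, |(f - g) (x j)| ≤ depthTol q k

/-- `cov` splits weak-star closed sets into finitely many pieces with centres. -/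
def IsCentredCover (q c : ℝ) (x : ℕ → X)
    (cov : ℕ → Set (StrongDual ℝ X) → List (Set (StrongDual ℝ X) × StrongDual ℝ X)) : Prop :=
  ∀ k K, IsWeakClosed K → K ⊆ closedBall 0 1 →
    (∀ D ∈ cov k K, IsWeakClosed D.1 ∧ D.1 ⊆ K ∧ D.2 ∈ D.1 ∧ ∀ f ∈ D.1, IsCentre q c x k D.2 f) ∧
      ∀ f ∈ K, ∃ D ∈ cov k K, f ∈ D.1

theorem depthTol_pos (q : ℝ) (k : ℕ) : 0 < depthTol q k := by
  unfold depthTol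
  positivity

theorem SharpAUS.exists_isCentredCover {C p : ℝ} (hpq : p.HolderConjugate q) (hC : 1 ≤ C)
    (h : SharpAUS C p X) (x : ℕ → X) :
    ∃ c : ℝ, 0 < c ∧ c ≤ 1 ∧ ∃ cov, IsCentredCover q c x cov := by
  obtain ⟨c, hc, hc1, hst⟩ := h.exists_dual_stability hpq hC
  refine ⟨c, hc, hc1, ?_⟩
  have key : ∀ (k : ℕ) (K : Set (StrongDual ℝ X)), IsWeakClosed K → K ⊆ closedBall 0 1 →
      ∃ L : List (Set (StrongDual ℝ X) × StrongDual ℝ X),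
        (∀ D ∈ L, IsWeakClosed D.1 ∧ D.1 ⊆ K ∧ D.2 ∈ D.1 ∧ ∀ f ∈ D.1, IsCentre q c x k D.2 f) ∧
          ∀ f ∈ K, ∃ D ∈ L, f ∈ D.1 := fun k K hK hK1 => by
    refine hK.exists_cover hK1 fun g hg => ?_
    obtain ⟨u, hu, η, hη, hgu⟩ := hst g (by simpa using hK1 hg) ((1 / 4) ^ k) (by positivity)
    refine ⟨u ∪ x '' Iio k, hu.union ((finite_Iio k).image x), min η (depthTol q k),
      lt_min hη (depthTol_pos q k), fun f hf hfu => ⟨hgu f hf fun v hv => ?_, fun j hj => ?_⟩⟩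
    · exact (hfu v (Or.inl hv)).trans (min_le_left _ _)
    · exact (hfu _ (Or.inr ⟨j, hj, rfl⟩)).trans (min_le_right _ _)
  choose! cov hcov using key
  exact ⟨cov, hcov⟩

/-- The weight, up to a factor two, of the edge from `g` at depth `k` to `g'`. -/
noncomputable def edgeGain (q : ℝ) (k : ℕ) (g g' : StrongDual ℝ X) : ℝ :=
  ‖g'‖ ^ q - ‖g‖ ^ q + (2 * (1 / 4) ^ k - 2 * (1 / 4) ^ (k + 1))

open Classical in
/-- The tree of pieces and centres; an edge is labelled by the number of the chosen piece and the
dyadic size of the gain, and wrong labels lead to dead nodes. -/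
noncomputable def dualNode (q : ℝ)
    (cov : ℕ → Set (StrongDual ℝ X) → List (Set (StrongDual ℝ X) × StrongDual ℝ X)) :
    List (ℕ × ℤ) → Set (StrongDual ℝ X) × StrongDual ℝ X
  | [] => (closedBall 0 1, 0)
  | a :: t =>
    if a.2 = Int.clog 2 (edgeGain q t.length (dualNode q cov t).2
        ((cov (t.length + 1) (dualNode q cov t).1)[a.1]?.getD (∅, 0)).2) then
      (cov (t.length + 1) (dualNode q cov t).1)[a.1]?.getD (∅, (dualNode q cov t).2)
    else (∅, (dualNode q cov t).2)

theorem dualNode_cons_cases (q : ℝ)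
    (cov : ℕ → Set (StrongDual ℝ X) → List (Set (StrongDual ℝ X) × StrongDual ℝ X))
    (a : ℕ × ℤ) (t : List (ℕ × ℤ)) :
    dualNode q cov (a :: t) = (∅, (dualNode q cov t).2) ∨
      ∃ D, (cov (t.length + 1) (dualNode q cov t).1)[a.1]? = some D ∧
        dualNode q cov (a :: t) = D ∧
        a.2 = Int.clog 2 (edgeGain q t.length (dualNode q cov t).2 D.2) := by
  rw [dualNode]
  split_ifs with h
  · cases hD : (cov (t.length + 1) (dualNode q cov t).1)[a.1]? with
    | none => exact Or.inl rfl
    | some D => exact Or.inr ⟨D, rfl, rfl, by rw [hD] at h; exact h⟩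
  · exact Or.inl rfl

theorem dualNode_spec (hc1 : c ≤ 1) (hq : 0 < q) (hcov : IsCentredCover q c x cov)
    (t : List (ℕ × ℤ)) :
    IsWeakClosed (dualNode q cov t).1 ∧ (dualNode q cov t).1 ⊆ closedBall 0 1 ∧
      ((dualNode q cov t).1 = ∅ ∨ (dualNode q cov t).2 ∈ (dualNode q cov t).1) ∧
      ∀ f ∈ (dualNode q cov t).1, IsCentre q c x t.length (dualNode q cov t).2 f := by
  induction t with
  | nil =>
    refine ⟨WeakDual.isClosed_closedBall 0 1, subset_rfl, Or.inr (by simp [dualNode]),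
      fun f _ => ⟨?_, by simp⟩⟩
    have : 0 ≤ ‖f‖ ^ q := by positivity
    simp only [dualNode, sub_zero, norm_zero, Real.zero_rpow hq.ne', List.length_nil, pow_zero]
    nlinarith
  | cons a t ih =>
    rcases dualNode_cons_cases q cov a t with h | ⟨D, hD, h, -⟩
    · simp [h, IsWeakClosed]
    · obtain ⟨h1, h2, h3, h4⟩ := (hcov (t.length + 1) _ ih.1 ih.2.1).1 D (List.mem_of_getElem? hD)
      rw [h]
      exact ⟨h1, h2.trans ih.2.1, Or.inr h3, h4⟩

theorem edgeGain_pos (hc : 0 ≤ c) {k : ℕ} {g f : StrongDual ℝ X} (h : IsCentre q c x k g f) :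
    0 < edgeGain q k g f := by
  have h1 := h.1
  have h2 : 0 ≤ c * ‖f - g‖ ^ q := mul_nonneg hc (by positivity)
  have h3 : (0 : ℝ) < (1 / 4) ^ k := by positivity
  rw [edgeGain, pow_succ]
  linarith

theorem dualNode_append (hq : 0 < q) (hc1 : c ≤ 1) (hcov : IsCentredCover q c x cov)
    (r l : List (ℕ × ℤ)) :
    (dualNode q cov (l ++ r)).1 ⊆ (dualNode q cov r).1 ∧
    ((dualNode q cov (l ++ r)).1 = ∅ ∨
      ‖(dualNode q cov (l ++ r)).2‖ ^ q - 2 * (1 / 4) ^ (l ++ r).length -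
        (‖(dualNode q cov r).2‖ ^ q - 2 * (1 / 4) ^ r.length) ≤
          (l.map fun a : ℕ × ℤ => (2 : ℝ) ^ a.2).sum) ∧
    ((dualNode q cov (l ++ r)).2 = (dualNode q cov r).2 ∨
      ((dualNode q cov (l ++ r)).2 ∈ (dualNode q cov r).1 ∧
      ‖(dualNode q cov (l ++ r)).2‖ ^ q - ‖(dualNode q cov r).2‖ ^ q + 3 / 2 * (1 / 4) ^ r.length ≤
          (l.map fun a : ℕ × ℤ => (2 : ℝ) ^ a.2).sum)) := by
  induction l with
  | nil => simp
  | cons a l ih =>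
    obtain ⟨ih1, ih2, ih3⟩ := ih
    have ha : (0 : ℝ) < 2 ^ a.2 := by positivity
    rw [List.cons_append]
    set t := l ++ r with ht
    rcases dualNode_cons_cases q cov a t with h | ⟨D, hD, h, haD⟩
    · refine ⟨by simp [h], Or.inl (by simp [h]), ?_⟩
      rw [h, List.map_cons, List.sum_cons]
      exact ih3.imp id fun h => ⟨h.1, by linarith [h.2]⟩
    · obtain ⟨hC, hC1, -⟩ := dualNode_spec hc1 hq hcov t
      obtain ⟨-, h2, h3, -⟩ := (hcov (t.length + 1) _ hC hC1).1 D (List.mem_of_getElem? hD)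
      have hne : (dualNode q cov t).1 ≠ ∅ := nonempty_iff_ne_empty.1 ⟨_, h2 h3⟩
      have hρ := ih2.resolve_left hne
      have hΔ : edgeGain q t.length (dualNode q cov t).2 D.2 ≤ 2 ^ a.2 := by
        rw [haD]
        exact_mod_cast Int.self_le_zpow_clog (b := 2) (by norm_num)
          (edgeGain q t.length (dualNode q cov t).2 D.2)
      rw [edgeGain] at hΔ
      have hlen : (1 / 4 : ℝ) ^ (t.length + 1) ≤ 1 / 4 * (1 / 4) ^ r.length := by
        rw [← pow_succ']
        refine pow_le_pow_of_le_one (by norm_num) (by norm_num) ?_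
        simp [ht]
      rw [h, List.map_cons, List.sum_cons, List.length_cons]
      exact ⟨h2.trans ih1, Or.inr (by linarith), Or.inr ⟨ih1 (h2 h3), by linarith⟩⟩

theorem finite_dualNode_nonempty (q : ℝ)
    (cov : ℕ → Set (StrongDual ℝ X) → List (Set (StrongDual ℝ X) × StrongDual ℝ X))
    (hcov : ∀ t, (dualNode q cov t).1 = ∅ →
      cov (t.length + 1) (dualNode q cov t).1 = []) (m : ℕ) :
    {s | s.length ≤ m ∧ (dualNode q cov s).1.Nonempty}.Finite := by
  induction m with
  | zero =>
    refine (finite_singleton []).subset fun s hs => ?_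
    simpa using hs.1
  | succ m ih =>
    refine ((ih.biUnion fun t _ => (finite_Iio
      (cov (t.length + 1) (dualNode q cov t).1).length).image fun i =>
        (i, Int.clog 2 (edgeGain q t.length (dualNode q cov t).2
          ((cov (t.length + 1) (dualNode q cov t).1)[i]?.getD (∅, 0)).2)) :: t).insert
        []).subset fun s hs => ?_
    obtain ⟨hlen, hne⟩ := hs
    cases s with
    | nil => exact mem_insert _ _
    | cons a t =>
      refine mem_insert_of_mem _ ?_
      rcases dualNode_cons_cases q cov a t with h | ⟨D, hD, h, haD⟩
      · simp [h] at hne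
      · obtain ⟨hlt, -⟩ := List.getElem?_eq_some_iff.1 hD
        refine mem_biUnion (x := t) ⟨by simpa using hlen, nonempty_iff_ne_empty.2 fun h0 => ?_⟩
          ⟨a.1, hlt, ?_⟩
        · rw [hcov t h0] at hlt
          simp at hlt
        · simp only [hD, Option.getD_some, ← haD]

theorem exists_dualNode_mem (hq : 0 < q) (hc : 0 ≤ c) (hc1 : c ≤ 1)
    (hcov : IsCentredCover q c x cov) {f : StrongDual ℝ X} (hf : ‖f‖ ≤ 1) (n : ℕ) :
    ∃ t : List (ℕ × ℤ), t.length = n ∧ f ∈ (dualNode q cov t).1 ∧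
      (t.map fun a : ℕ × ℤ => (2 : ℝ) ^ a.2).sum ≤
        2 * (‖(dualNode q cov t).2‖ ^ q - 2 * (1 / 4) ^ n + 2) := by
  induction n with
  | zero => exact ⟨[], rfl, by simpa [dualNode] using hf, by simp [dualNode, hq.ne']⟩
  | succ n ih =>
    obtain ⟨t, rfl, hft, hsum⟩ := ih
    obtain ⟨hC, hC1, -, hcen⟩ := dualNode_spec hc1 hq hcov t
    obtain ⟨hcov1, hcov2⟩ := hcov (t.length + 1) _ hC hC1
    obtain ⟨D, hD, hfD⟩ := hcov2 f hft
    obtain ⟨-, h2, h3, -⟩ := hcov1 D hD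
    obtain ⟨i, hi⟩ := List.mem_iff_getElem?.1 hD
    have hpos := edgeGain_pos hc (hcen _ (h2 h3))
    set w := Int.clog 2 (edgeGain q t.length (dualNode q cov t).2 D.2) with hw
    have hnode : dualNode q cov ((i, w) :: t) = D := by
      rw [dualNode, hi, Option.getD_some, Option.getD_some, if_pos hw]
    have h2w : (2 : ℝ) ^ w ≤ 2 * edgeGain q t.length (dualNode q cov t).2 D.2 := by
      have := Int.zpow_pred_clog_lt_self (b := 2) (by norm_num) hpos
      rw [← hw, zpow_sub_one₀ (by norm_num)] at this
      push_cast at this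
      linarith
    refine ⟨(i, w) :: t, rfl, by rw [hnode]; exact hfD, ?_⟩
    rw [hnode, List.map_cons, List.sum_cons]
    rw [edgeGain] at h2w
    linarith

theorem IsCentredCover.isFunctionalTree (hcov : IsCentredCover q c x cov) (hq : 0 < q)
    (hc : 0 < c) (hc1 : c ≤ 1) :
    IsFunctionalTree (fun a : ℕ × ℤ => (2 : ℝ) ^ a.2) q ((1 / c) ^ (1 / q)) (6 ^ (1 / q)) x
      fun t => (dualNode q cov t).2 := by
  have hθ : ∀ a : ℕ × ℤ, (0 : ℝ) < 2 ^ a.2 := fun a => by positivity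
  have hsum := sum_map_nonneg hθ
  refine ⟨rfl, fun l r => ?_, fun j η hη => ?_, fun m => ?_, fun f hf j η hη => ?_⟩
  · rcases (dualNode_append hq hc1 hcov r l).2.2 with h | ⟨h1, h2⟩
    · rw [h, sub_self, norm_zero]
      exact mul_nonneg (by positivity) (segWeight_nonneg hθ l)
    · have h3 := ((dualNode_spec hc1 hq hcov r).2.2.2 _ h1).1
      have h4 : (0 : ℝ) < (1 / 4) ^ r.length := by positivity
      rw [segWeight, ← Real.mul_rpow (by positivity) (hsum l), one_div q,
        Real.le_rpow_inv_iff_of_pos (norm_nonneg _) (mul_nonneg (by positivity) (hsum l)) hq,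
        one_div_mul_eq_div, le_div_iff₀ hc]
      linarith
  · obtain ⟨m, hm⟩ := exists_nat_gt (1 / η)
    refine ⟨max m (j + 1), fun r hr l => ?_⟩
    have hmr : (m : ℝ) ≤ r.length := by exact_mod_cast (le_max_left _ _).trans hr
    have hjr : j < r.length := (le_max_right _ _).trans hr
    rcases (dualNode_append hq hc1 hcov r l).2.2 with h | ⟨h1, h2⟩
    · rw [h, sub_self, zero_apply, abs_zero]
      exact mul_nonneg hη.le (segWeight_nonneg hθ l)
    · obtain ⟨h3, h4⟩ := (dualNode_spec hc1 hq hcov r).2.2.2 _ h1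
      have h5 : 0 ≤ c * ‖(dualNode q cov (l ++ r)).2 - (dualNode q cov r).2‖ ^ q := by positivity
      refine (h4 j hjr).trans ?_
      unfold depthTol segWeight
      gcongr
      · rw [div_le_iff₀ (by positivity)]
        rw [div_lt_iff₀ hη] at hm
        nlinarith
      · linarith
  · refine (finite_dualNode_nonempty q cov (fun t ht => ?_) m).subset fun s hs =>
      ⟨hs.1, nonempty_iff_ne_empty.2 fun h0 => hs.2 ?_⟩
    · obtain ⟨hC, hC1, -⟩ := dualNode_spec hc1 hq hcov t
      refine List.eq_nil_iff_forall_not_mem.2 fun D hD => ?_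
      obtain ⟨-, h2, h3, -⟩ := (hcov (t.length + 1) _ hC hC1).1 D hD
      simpa [ht] using h2 h3
    · cases s with
      | nil => rfl
      | cons a t =>
        rcases dualNode_cons_cases q cov a t with h | ⟨D, hD, h, -⟩
        · rw [h, List.tail_cons]
        · obtain ⟨hC, hC1, -⟩ := dualNode_spec hc1 hq hcov t
          obtain ⟨-, -, h3, -⟩ := (hcov (t.length + 1) _ hC hC1).1 D (List.mem_of_getElem? hD)
          rw [← h, h0] at h3
          exact h3.elim
  · obtain ⟨m, hm⟩ := exists_nat_gt (1 / η)
    obtain ⟨t, ht, hft, hst⟩ := exists_dualNode_mem hq hc.le hc1 hcov hf (max m (j + 1))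
    have hmr : (m : ℝ) ≤ t.length := by rw [ht]; exact_mod_cast le_max_left _ _
    have hjr : j < t.length := by rw [ht]; exact Nat.lt_of_succ_le (le_max_right _ _)
    obtain ⟨-, hC1, hmem, hcen⟩ := dualNode_spec hc1 hq hcov t
    have hg : ‖(dualNode q cov t).2‖ ≤ 1 := by
      simpa using hC1 (hmem.resolve_left (nonempty_iff_ne_empty.1 ⟨f, hft⟩))
    refine ⟨t, Real.rpow_le_rpow (hsum t) ?_ (by positivity), ?_⟩
    · have h1 : ‖(dualNode q cov t).2‖ ^ q ≤ 1 := Real.rpow_le_one (norm_nonneg _) hg hq.le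
      have h2 : (0 : ℝ) < (1 / 4) ^ max m (j + 1) := by positivity
      linarith
    · rw [abs_sub_comm, ← sub_apply]
      refine ((hcen f hft).2 j hjr).trans ?_
      have h1 : ((1 / 4 : ℝ) ^ t.length / 2) ^ (1 / q) ≤ 1 := by
        refine Real.rpow_le_one (by positivity) ?_ (by positivity)
        have : (1 / 4 : ℝ) ^ t.length ≤ 1 := pow_le_one₀ (by norm_num) (by norm_num)
        linarith
      have h2 : 1 / ((t.length : ℝ) + 1) ≤ η := by
        rw [div_le_iff₀ (by positivity)]
        rw [div_lt_iff₀ hη] at hm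
        nlinarith
      unfold depthTol
      calc _ ≤ η * 1 := by gcongr
        _ = η := mul_one η

end DualTree

section LevelTree

variable {q : ℝ}

/-- Arrays `Ψ n a` of reals, `2 ^ n`-periodic in `a`, whose increments in `n` are controlled by
the increments of a monotone function `W`. -/
def levelArrays (q : ℝ) : Set (ℕ → ℕ → ℝ) :=
  {Ψ | (∀ n a, Ψ n (a % 2 ^ n) = Ψ n a) ∧ ∃ W : ℕ → ℝ, Monotone W ∧ (∀ n, 0 ≤ W n) ∧
    (∀ n, W n ≤ 1) ∧ (∀ n a, |Ψ n a| ^ q ≤ W (n + 1)) ∧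
    ∀ n m a, n ≤ m → |Ψ m a - Ψ n a| ^ q ≤ W (m + 1) - W n}

theorem abs_le_one_of_mem_levelArrays (hq : 0 < q) {Ψ : ℕ → ℕ → ℝ} (hΨ : Ψ ∈ levelArrays q)
    (n a : ℕ) : |Ψ n a| ≤ 1 := by
  obtain ⟨-, W, -, -, h1, h, -⟩ := hΨ
  by_contra! h2
  exact absurd ((h n a).trans (h1 _)) (Real.one_lt_rpow h2 hq).not_ge

/-- The element of `EllInf` attached to the position `a` of level `n`. -/
noncomputable def levelVec (hq : 0 < q) (i : ℕ × ℕ) : EllInf (levelArrays q) :=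
  EllInf.ofLe (fun Ψ => Ψ.1 i.1 i.2) (B := 1)
    fun Ψ => abs_le_one_of_mem_levelArrays hq Ψ.2 i.1 i.2

theorem levelVec_apply (hq : 0 < q) (i : ℕ × ℕ) (Ψ : levelArrays q) :
    levelVec hq i Ψ = Ψ.1 i.1 i.2 := rfl

theorem norm_levelVec_le (hq : 0 < q) (i : ℕ × ℕ) : ‖levelVec hq i‖ ≤ 1 :=
  EllInf.norm_le zero_le_one fun Ψ => abs_le_one_of_mem_levelArrays hq Ψ.2 i.1 i.2

theorem levelVec_mod (hq : 0 < q) (n a : ℕ) : levelVec hq (n, a % 2 ^ n) = levelVec hq (n, a) := by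
  ext Ψ
  exact Ψ.2.1 n a

theorem abs_div_rpow_le {q A u w W : ℝ} (hA : 0 < A) (hAW : A ^ q = W) (h : |u| ^ q ≤ w) :
    |u / A| ^ q ≤ w / W := by
  rw [abs_div, abs_of_pos hA, Real.div_rpow (abs_nonneg _) hA.le, hAW]
  have : 0 < W := hAW ▸ Real.rpow_pos_of_pos hA q
  gcongr

theorem initial_mem_levelArrays (hq : 0 < q) {Ψ : ℕ → ℕ → ℝ} {W : ℕ → ℝ}
    (hmod : ∀ n a, Ψ n (a % 2 ^ n) = Ψ n a) (hW : Monotone W) (hW0 : ∀ n, 0 ≤ W n)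
    (hΨ : ∀ n a, |Ψ n a| ^ q ≤ W (n + 1))
    (hinc : ∀ n m a, n ≤ m → |Ψ m a - Ψ n a| ^ q ≤ W (m + 1) - W n) {n : ℕ} {A : ℝ} (hA : 0 < A)
    (hAW : A ^ q = W (n + 1)) : (fun k a => Ψ (min k n) a / A) ∈ levelArrays q := by
  have hpos : 0 < W (n + 1) := hAW ▸ Real.rpow_pos_of_pos hA q
  refine ⟨fun k a => ?_, fun k => W (min k (n + 1)) / W (n + 1), fun k m hkm => ?_,
    fun k => div_nonneg (hW0 _) hpos.le, fun k => ?_, fun k a => ?_, fun k m a hkm => ?_⟩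
  · simp only
    rw [← hmod, Nat.mod_mod_of_dvd _ (pow_dvd_pow 2 (min_le_left k n)), hmod]
  · simp only
    gcongr
    exact hW (min_le_min_right _ hkm)
  · exact div_le_one_of_le₀ (hW (min_le_right _ _)) hpos.le
  · refine abs_div_rpow_le hA hAW ?_
    rw [min_add_add_right]
    exact hΨ _ _
  · rw [← sub_div, ← sub_div]
    refine abs_div_rpow_le hA hAW ?_
    rw [min_add_add_right]
    rcases le_or_gt k n with hk | hk
    · rw [min_eq_left hk, min_eq_left (hk.trans n.le_succ)]
      exact hinc _ _ _ (le_min hkm hk)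
    · rw [min_eq_right hk.le, min_eq_right (hk.le.trans hkm), min_eq_right hk]
      simp [hq.ne']

theorem final_mem_levelArrays (hq : 0 < q) {Ψ : ℕ → ℕ → ℝ} {W : ℕ → ℝ}
    (hmod : ∀ n a, Ψ n (a % 2 ^ n) = Ψ n a) (hW : Monotone W) (hW1 : ∀ n, W n ≤ 1)
    (hinc : ∀ n m a, n ≤ m → |Ψ m a - Ψ n a| ^ q ≤ W (m + 1) - W n) {n : ℕ} {B : ℝ} (hB : 0 < B)
    (hBW : B ^ q = 1 - W n) : (fun k a => (Ψ (max k n) a - Ψ n a) / B) ∈ levelArrays q := by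
  have hpos : 0 < 1 - W n := hBW ▸ Real.rpow_pos_of_pos hB q
  have hinc' : ∀ k m a, k ≤ m → |Ψ (max m n) a - Ψ (max k n) a| ^ q ≤
      W (max (m + 1) n) - W (max k n) := fun k m a hkm => by
    rcases le_or_gt m n with hm | hm
    · rw [max_eq_right hm, max_eq_right (hkm.trans hm)]
      simpa [hq.ne'] using hW (le_max_right _ _)
    · rw [max_eq_left hm.le, max_eq_left (hm.le.trans m.le_succ)]
      exact hinc _ _ _ (max_le hkm hm.le)
  refine ⟨fun k a => ?_, fun k => (W (max k n) - W n) / (1 - W n), fun k m hkm => ?_,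
    fun k => div_nonneg (sub_nonneg.2 (hW (le_max_right _ _))) hpos.le, fun k => ?_, fun k a => ?_,
    fun k m a hkm => ?_⟩
  · simp only
    rcases le_total k n with hk | hk
    · simp [max_eq_right hk]
    · rw [max_eq_left hk, hmod, ← hmod n, Nat.mod_mod_of_dvd _ (pow_dvd_pow 2 hk), hmod]
  · simp only
    gcongr
    exact hW (max_le_max_right _ hkm)
  · exact div_le_one_of_le₀ (by linarith [hW1 (max k n)]) hpos.le
  · refine abs_div_rpow_le hB hBW ?_
    simpa using hinc' 0 k a (Nat.zero_le _)
  · rw [← sub_div, ← sub_div, sub_sub_sub_cancel_right, sub_sub_sub_cancel_right]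
    exact abs_div_rpow_le hB hBW (hinc' k m a hkm)

theorem ausWith_levelVec {p : ℝ} (hpq : p.HolderConjugate q) :
    AUSWith 1 p (Submodule.span ℝ (range (levelVec hpq.symm.pos))).topologicalClosure := by
  have hq := hpq.symm.pos
  refine ausWith_one_of_split hpq _ (fun n => levelVec hq '' {i | i.1 ≤ n})
    (fun n => {y | ∃ k a, n ≤ k ∧ y = levelVec hq (k, a) - levelVec hq (n, a)}) (fun n => ?_)
    (fun n => ?_) (fun m n hmn => ?_) (fun i => ?_) (fun n i => ?_) (fun n => ⟨n + 1, fun Ψ => ?_⟩)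
  · refine (((finite_Iic n).prod (finite_Iio (2 ^ n))).image (levelVec hq)).subset ?_
    rintro _ ⟨⟨k, a⟩, hk, rfl⟩
    exact ⟨(k, a % 2 ^ k), ⟨hk, (Nat.mod_lt _ (by positivity)).trans_le
      (pow_le_pow_right₀ one_le_two hk)⟩, levelVec_mod hq k a⟩
  · exact (image_subset_range _ _).trans Submodule.subset_span
  · exact image_mono fun i (hi : _ ≤ m) => hi.trans hmn
  · exact ⟨i.1, i, le_refl i.1, rfl⟩
  · rcases le_total i.1 n with h | h
    · exact Submodule.mem_sup_left (Submodule.subset_span (mem_image_of_mem _ h))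
    · rw [← add_sub_cancel (levelVec hq (n, i.2)) (levelVec hq i)]
      exact add_mem (Submodule.mem_sup_left (Submodule.subset_span ⟨(n, i.2), le_refl n, rfl⟩))
        (Submodule.mem_sup_right (Submodule.subset_span ⟨i.1, i.2, h, rfl⟩))
  · obtain ⟨Ψ, hΨm⟩ := Ψ
    have hΨm' := hΨm
    obtain ⟨hmod, W, hW, hW0, hW1, hΨ, hinc⟩ := hΨm'
    have hA : (W (n + 1) ^ q⁻¹) ^ q = W (n + 1) := Real.rpow_inv_rpow (hW0 _) hq.ne'
    have hB : ((1 - W (n + 1)) ^ q⁻¹) ^ q = 1 - W (n + 1) :=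
      Real.rpow_inv_rpow (sub_nonneg.2 (hW1 _)) hq.ne'
    set A := W (n + 1) ^ q⁻¹ with hAdef
    set B := (1 - W (n + 1)) ^ q⁻¹ with hBdef
    have hA0 : 0 ≤ A := Real.rpow_nonneg (hW0 _) _
    have hB0 : 0 ≤ B := Real.rpow_nonneg (sub_nonneg.2 (hW1 _)) _
    have hfirst : ∃ Φ : levelArrays q, ∀ x ∈ levelVec hq '' {i | i.1 ≤ n},
        x ⟨Ψ, hΨm⟩ = A * x Φ := by
      rcases hA0.eq_or_lt with h0 | h0
      · refine ⟨⟨Ψ, hΨm⟩, ?_⟩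
        rintro _ ⟨i, hi, rfl⟩
        rw [← h0, zero_mul, levelVec_apply]
        rw [← h0, Real.zero_rpow hq.ne'] at hA
        have h1 := (hΨ i.1 i.2).trans (hW (Nat.succ_le_succ hi))
        rw [← hA] at h1
        by_contra h2
        exact (Real.rpow_pos_of_pos (abs_pos.2 h2) q).not_ge h1
      · refine ⟨⟨_, initial_mem_levelArrays hq hmod hW hW0 hΨ hinc h0 hA⟩, ?_⟩
        rintro _ ⟨i, hi, rfl⟩
        simp only [levelVec_apply]
        rw [min_eq_left hi, mul_div_cancel₀ _ h0.ne']
    have hfin : ∃ Φ : levelArrays q, ∀ y ∈ {y | ∃ k a, n + 1 ≤ k ∧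
        y = levelVec hq (k, a) - levelVec hq (n + 1, a)}, y ⟨Ψ, hΨm⟩ = B * y Φ := by
      rcases hB0.eq_or_lt with h0 | h0
      · refine ⟨⟨Ψ, hΨm⟩, ?_⟩
        rintro _ ⟨k, a, hk, rfl⟩
        rw [← h0, zero_mul]
        rw [← h0, Real.zero_rpow hq.ne'] at hB
        have h1 := hinc (n + 1) k a hk
        change Ψ k a - Ψ (n + 1) a = 0
        by_contra h2
        have h3 := Real.rpow_pos_of_pos (abs_pos.2 h2) q
        linarith [hW1 (k + 1)]
      · refine ⟨⟨_, final_mem_levelArrays hq hmod hW hW1 hinc h0 hB⟩, ?_⟩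
        rintro _ ⟨k, a, hk, rfl⟩
        change Ψ k a - Ψ (n + 1) a = B * ((Ψ (max k (n + 1)) a - Ψ (n + 1) a) / B -
          (Ψ (max (n + 1) (n + 1)) a - Ψ (n + 1) a) / B)
        rw [max_eq_left hk, max_self, sub_self, zero_div, sub_zero, mul_div_cancel₀ _ h0.ne']
    obtain ⟨Φ₁, h₁⟩ := hfirst
    obtain ⟨Φ₂, h₂⟩ := hfin
    exact ⟨Φ₁, Φ₂, A, B, hA0, hB0, by rw [hA, hB]; linarith, h₁, h₂⟩

end LevelTree

section Surjectivity

variable {X Z : Type*} [NormedAddCommGroup X] [NormedSpace ℝ X] [NormedAddCommGroup Z]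
  [NormedSpace ℝ Z]

theorem ContinuousLinearMap.surjective_of_dense_unit [CompleteSpace Z] {Q : Z →L[ℝ] X}
    (h : ∀ y : X, ‖y‖ ≤ 1 → ∀ ε : ℝ, 0 < ε → ∃ z, ‖z‖ ≤ 1 ∧ ‖y - Q z‖ ≤ ε) :
    Function.Surjective Q := by
  have key : ∀ y : X, ∃ z, ‖z‖ ≤ ‖y‖ ∧ ‖y - Q z‖ ≤ 1 / 2 * ‖y‖ := fun y => by
    rcases eq_or_ne y 0 with rfl | hy
    · exact ⟨0, by simp, by simp⟩
    have hy0 : 0 < ‖y‖ := norm_pos_iff.2 hy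
    obtain ⟨z, hz, hyz⟩ := h (‖y‖⁻¹ • y) (by
      rw [norm_smul, norm_inv, norm_norm, inv_mul_cancel₀ hy0.ne']) (1 / 2) (by norm_num)
    refine ⟨‖y‖ • z, ?_, ?_⟩
    · rw [norm_smul, norm_norm]
      exact mul_le_of_le_one_right hy0.le hz
    · have : y - Q (‖y‖ • z) = ‖y‖ • (‖y‖⁻¹ • y - Q z) := by
        rw [map_smul, smul_sub, smul_inv_smul₀ hy0.ne']
      rw [this, norm_smul, norm_norm, mul_comm]
      gcongr
  choose g hg hgQ using key
  intro y
  let r : ℕ → X := fun n => (fun y => y - Q (g y))^[n] y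
  have hr : ∀ n, ‖r n‖ ≤ (1 / 2) ^ n * ‖y‖ := fun n => by
    induction n with
    | zero => simp [r]
    | succ n ih =>
      have : r (n + 1) = r n - Q (g (r n)) := Function.iterate_succ_apply' _ _ _
      rw [this, pow_succ']
      linarith [hgQ (r n)]
  have hsum : Summable fun n => g (r n) :=
    .of_norm_bounded ((summable_geometric_of_lt_one (by norm_num) (by norm_num :
      (1 / 2 : ℝ) < 1)).mul_right ‖y‖) fun n => (hg _).trans (hr n)
  refine ⟨∑' n, g (r n), ?_⟩
  have hpart : ∀ n, Q (∑ i ∈ Finset.range n, g (r i)) = y - r n := fun n => by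
    induction n with
    | zero => simp [r]
    | succ n ih =>
      have : r (n + 1) = r n - Q (g (r n)) := Function.iterate_succ_apply' _ _ _
      rw [Finset.sum_range_succ, map_add, ih, this]
      abel
  have hr0 : Tendsto r atTop (𝓝 0) := by
    refine squeeze_zero_norm hr ?_
    simpa using (tendsto_pow_atTop_nhds_zero_of_lt_one (by norm_num)
      (by norm_num : (1 / 2 : ℝ) < 1)).mul_const ‖y‖
  have h1 := (Q.continuous.tendsto _).comp hsum.hasSum.tendsto_sum_nat
  have h2 : Tendsto (fun n => y - r n) atTop (𝓝 y) := by
    simpa using hr0.const_sub y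
  exact tendsto_nhds_unique h1 (h2.congr fun n => (hpart n).symm)

/-- A bounded operator on the closed span of a family is determined by the domination of all
finite linear combinations. -/
theorem exists_clm_closure_span [CompleteSpace X] {ι : Type*} {d : ι → Z} {v : ι → X} {K : ℝ}
    (h : ∀ φ : ι →₀ ℝ, ‖Finsupp.linearCombination ℝ v φ‖ ≤
      K * ‖Finsupp.linearCombination ℝ d φ‖) :
    ∃ Q : (Submodule.span ℝ (range d)).topologicalClosure →L[ℝ] X, ∀ i,
      Q ⟨d i, (Submodule.span ℝ (range d)).le_topologicalClosure
        (Submodule.subset_span (mem_range_self i))⟩ = v i := by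
  set S := Submodule.span ℝ (range d) with hS
  have hmem : ∀ φ, Finsupp.linearCombination ℝ d φ ∈ S.topologicalClosure := fun φ => by
    refine S.le_topologicalClosure ?_
    rw [hS, ← Finsupp.range_linearCombination]
    exact LinearMap.mem_range_self _ φ
  let e : (ι →₀ ℝ) →ₗ[ℝ] S.topologicalClosure :=
    (Finsupp.linearCombination ℝ d).codRestrict S.topologicalClosure hmem
  have hdense : DenseRange e := by
    rintro ⟨z, hz⟩
    rw [closure_subtype]
    have h1 : range (Finsupp.linearCombination ℝ d) = (S : Set Z) := by
      rw [hS, ← Finsupp.range_linearCombination]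
      rfl
    have h2 : (Subtype.val '' range e : Set Z) = S := by
      rw [← range_comp, ← h1]
      rfl
    rw [h2]
    exact hz
  refine ⟨(Finsupp.linearCombination ℝ v).extendOfNorm e, fun i => ?_⟩
  have h1 := LinearMap.extendOfNorm_eq (f := Finsupp.linearCombination ℝ v) hdense ⟨K, h⟩
    (Finsupp.single i 1)
  rw [Finsupp.linearCombination_single, one_smul] at h1
  rw [← h1]
  congr 1
  ext1
  simp [e]

end Surjectivity

section RestrictedNorm

variable {X : Type*} [NormedAddCommGroup X] [NormedSpace ℝ X] {C κ p q : ℝ}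

/-- The norm of the restriction of a functional to a subspace. -/
noncomputable def restrNorm (h : StrongDual ℝ X) (F : Submodule ℝ X) : ℝ := ‖h.comp F.subtypeL‖

theorem restrNorm_nonneg (h : StrongDual ℝ X) (F : Submodule ℝ X) : 0 ≤ restrNorm h F :=
  norm_nonneg (h.comp F.subtypeL)

theorem abs_apply_le_restrNorm (h : StrongDual ℝ X) {F : Submodule ℝ X} {y : X} (hy : y ∈ F) :
    |h y| ≤ restrNorm h F * ‖y‖ :=
  (h.comp F.subtypeL).le_opNorm ⟨y, hy⟩

theorem restrNorm_mono (h : StrongDual ℝ X) : Monotone (restrNorm h) := fun _ F' hF =>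
  ContinuousLinearMap.opNorm_le_bound _ (restrNorm_nonneg h F') fun v =>
    abs_apply_le_restrNorm h (hF v.2)

theorem restrNorm_le (h : StrongDual ℝ X) (F : Submodule ℝ X) : restrNorm h F ≤ ‖h‖ :=
  ContinuousLinearMap.opNorm_le_bound _ (norm_nonneg _) fun v => h.le_opNorm v

theorem exists_lt_apply_of_restrNorm (h : StrongDual ℝ X) (F : Submodule ℝ X) {η : ℝ}
    (hη : 0 < η) : ∃ v ∈ F, ‖v‖ ≤ 1 ∧ restrNorm h F - η ≤ h v := by
  obtain ⟨v, hv, hhv⟩ := (h.comp F.subtypeL).exists_lt_apply_of_lt_opNorm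
    (sub_lt_self (restrNorm h F) hη)
  change _ < |h v| at hhv
  rcases abs_cases (h v) with ⟨h1, -⟩ | ⟨h1, -⟩
  · exact ⟨v, v.2, hv.le, by linarith⟩
  · exact ⟨-v, neg_mem v.2, by rw [norm_neg]; exact hv.le, by rw [map_neg]; linarith⟩

/-- Values of a functional on vectors almost lying in an asymptotic complement of `F` are
controlled by the growth of the norms of its restrictions. -/
theorem rpow_abs_apply_le_restrNorm (hpq : p.HolderConjugate q) (hC : 0 ≤ C) (hκ : 0 < κ)
    (hκ1 : κ ≤ 1) (hCκ : C * κ ^ p ≤ κ) {F F' H : Submodule ℝ X} (hF : F ≤ F') {η : ℝ}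
    (hη : 0 < η) (hη1 : η ≤ 1)
    (hH : ∀ y ∈ F, ‖y‖ ≤ 1 → ∀ x ∈ H, ‖x‖ ≤ 1 → ∀ σ τ : ℝ, 0 ≤ σ → σ ≤ 1 → 0 ≤ τ →
      ‖σ • y + τ • x‖ ≤ (σ ^ p + C * τ ^ p) ^ (1 / p) + η)
    {y e : X} (hy : y ∈ F') (hy2 : ‖y‖ ≤ 2) (he : e ∈ H) (hye : ‖y - e‖ ≤ η)
    {h : StrongDual ℝ X} (hh : ‖h‖ ≤ 1) :
    κ / 4 ^ q * |h y| ^ q ≤ restrNorm h F' ^ q - restrNorm h F ^ q + 3 * q * η := by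
  wlog hpos : 0 ≤ h y generalizing y e
  · have := this (neg_mem hy) (by rwa [norm_neg]) (neg_mem he)
      (by rwa [← neg_sub', norm_neg])
      (by rw [map_neg]; linarith)
    rwa [map_neg, abs_neg] at this
  have hq := hpq.symm.pos
  obtain ⟨v, hv, hv1, hhv⟩ := exists_lt_apply_of_restrNorm h F hη
  have hN := restrNorm_nonneg h F'
  have hN1 := (restrNorm_le h F').trans hh
  have he4 : ‖(4⁻¹ : ℝ) • e‖ ≤ 1 := by
    have h1 : e = y - (y - e) := by abel
    have h2 : ‖e‖ ≤ 3 := by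
      rw [h1]
      exact (norm_sub_le _ _).trans (by linarith)
    rw [norm_smul]
    norm_num
    linarith
  have hb1 : h y / 4 ≤ 1 := by
    have h1 := (le_abs_self _).trans (h.le_opNorm y)
    nlinarith [norm_nonneg y, norm_nonneg h]
  have hmain := rpow_add_mul_rpow_le hpq hC hκ hκ1 hCκ (restrNorm_nonneg h F)
    ((restrNorm_le h F).trans hh) (by positivity) hb1 hN (η := 3 * η)
    fun σ τ hσ hσ1 hτ hτ1 => by
      have hmem : σ • v + τ • (4⁻¹ : ℝ) • y ∈ F' :=
        add_mem (F'.smul_mem _ (hF hv)) (F'.smul_mem _ (F'.smul_mem _ hy))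
      have h1 := (le_abs_self _).trans (abs_apply_le_restrNorm h hmem)
      have h2 : ‖σ • v + τ • (4⁻¹ : ℝ) • y‖ ≤ (σ ^ p + C * τ ^ p) ^ (1 / p) + 2 * η := by
        have h3 : σ • v + τ • (4⁻¹ : ℝ) • y =
            (σ • v + τ • (4⁻¹ : ℝ) • e) + (τ * 4⁻¹) • (y - e) := by
          rw [smul_sub, mul_smul, mul_smul]
          abel
        rw [h3]
        refine (norm_add_le _ _).trans ?_
        have h4 : ‖(τ * 4⁻¹) • (y - e)‖ ≤ η := by
          rw [norm_smul, Real.norm_of_nonneg (by positivity)]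
          nlinarith [norm_nonneg (y - e)]
        linarith [hH v hv hv1 _ (H.smul_mem _ he) he4 σ τ hσ hσ1 hτ]
      simp only [map_add, map_smul, smul_eq_mul] at h1
      have h5 := mul_le_mul_of_nonneg_left h2 hN
      have h6 : σ * restrNorm h F ≤ σ * h v + η := by nlinarith
      nlinarith
  have h7 : κ / 4 ^ q * |h y| ^ q = κ * (h y / 4) ^ q := by
    rw [abs_of_nonneg hpos, Real.div_rpow hpos (by norm_num)]
    ring
  rw [h7]
  linarith

end RestrictedNorm

section NetTree

variable {X : Type*} [NormedAddCommGroup X] [NormedSpace ℝ X] {C p : ℝ} {η : ℕ → ℝ} {x : ℕ → X}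

/-- One level of a tree of subsets of the unit ball: at position `a` stands the set `cell a` with
centre `centre a`; positions are taken modulo `2 ^ size`. -/
structure NetLevel (X : Type*) [NormedAddCommGroup X] [NormedSpace ℝ X] where
  /-- The logarithm of the number of positions. -/
  size : ℕ
  /-- The centres. -/
  centre : ℕ → X
  /-- The cells. -/
  cell : ℕ → Set X
  /-- A subspace containing all centres. -/
  space : Submodule ℝ X
  centre_mod : ∀ a, centre (a % 2 ^ size) = centre a
  cell_mod : ∀ a, cell (a % 2 ^ size) = cell a
  centre_mem_cell : ∀ a, centre a ∈ cell a
  cell_subset : ∀ a, cell a ⊆ closedBall 0 1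
  centre_mem_space : ∀ a, centre a ∈ space
  finite_space : FiniteDimensional ℝ space
  cover : ∀ y ∈ closedBall (0 : X) 1, ∃ a, y ∈ cell a

/-- The level consisting of the unit ball alone. -/
def NetLevel.root (X : Type*) [NormedAddCommGroup X] [NormedSpace ℝ X] : NetLevel X where
  size := 0
  centre _ := 0
  cell _ := closedBall 0 1
  space := ⊥
  centre_mod _ := rfl
  cell_mod _ := rfl
  centre_mem_cell _ := by simp
  cell_subset _ := subset_rfl
  centre_mem_space _ := zero_mem _
  finite_space := inferInstance
  cover _ hy := ⟨0, hy⟩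

/-- `T` refines `S` up to `η`, modulo a subspace on which the norm is smooth relative to the
space of `S`, and the vector `v` is one of the centres of `T`. -/
def NetLevel.Refines (C p η : ℝ) (v : X) (S T : NetLevel X) : Prop :=
  S.size < T.size ∧ S.space ≤ T.space ∧ (∀ a, T.cell a ⊆ S.cell a) ∧ (∃ a, T.centre a = v) ∧
    ∃ H : Submodule ℝ X, (∀ a, ∀ y ∈ T.cell a, ∃ e ∈ H, ‖y - T.centre a - e‖ ≤ η) ∧
      ∀ y ∈ S.space, ‖y‖ ≤ 1 → ∀ e ∈ H, ‖e‖ ≤ 1 → ∀ σ τ : ℝ, 0 ≤ σ → σ ≤ 1 → 0 ≤ τ →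
        ‖σ • y + τ • e‖ ≤ (σ ^ p + C * τ ^ p) ^ (1 / p) + η

theorem Set.Finite.exists_enum {β : Type*} {s : Set β} (hs : s.Finite) (hne : s.Nonempty) :
    ∃ (e : ℕ → β) (N : ℕ), (∀ i, e i ∈ s) ∧ ∀ b ∈ s, ∃ i < N, e i = b := by
  obtain ⟨e, rfl⟩ := hs.countable.exists_eq_range hne
  choose! g hg using fun b (hb : b ∈ range e) => hb
  obtain ⟨N, hN⟩ := (hs.image g).bddAbove
  exact ⟨e, N + 1, mem_range_self, fun b hb =>
    ⟨g b, Nat.lt_succ_of_le (hN (mem_image_of_mem g hb)), hg b hb⟩⟩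

theorem exists_nat_forall_lt_two_pow (N : ℕ → ℕ) (n : ℕ) :
    ∃ m, 0 < m ∧ ∀ a < n, N a ≤ 2 ^ m := by
  refine ⟨(Finset.range n).sup N + 1, Nat.succ_pos _, fun a ha => ?_⟩
  have h1 : N a ≤ (Finset.range n).sup N := Finset.le_sup (Finset.mem_range.2 ha)
  exact (h1.trans (Nat.le_succ _)).trans Nat.lt_two_pow_self.le

theorem NetLevel.exists_refines (h : SharpAUS C p X) {δ : ℝ} (hδ : 0 < δ) {v : X}
    (hv : ‖v‖ ≤ 1) (S : NetLevel X) : ∃ T : NetLevel X, S.Refines C p δ v T := by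
  have := S.finite_space
  have htb : TotallyBounded ((S.space : Set X) ∩ closedBall 0 1) := by
    have : ProperSpace S.space := FiniteDimensional.proper_real _
    have h1 := ((isCompact_closedBall (0 : S.space) 1).image
      continuous_subtype_val).totallyBounded
    refine TotallyBounded.subset (fun y hy => ?_) h1
    exact ⟨⟨y, hy.1⟩, by simpa using hy.2, rfl⟩
  obtain ⟨H, hH, hHb⟩ := h _ htb inter_subset_right δ hδ
  choose G hGf hGs hG using fun a => hH.exists_finite_net (S.cell_subset a) hδ
  have hG'f : ∀ a, (G a ∪ ({v} ∩ S.cell a)).Finite := fun a =>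
    (hGf a).union ((finite_singleton v).inter_of_left _)
  have hG's : ∀ a, G a ∪ ({v} ∩ S.cell a) ⊆ S.cell a := fun a =>
    union_subset (hGs a) inter_subset_right
  have hG'ne : ∀ a, (G a ∪ ({v} ∩ S.cell a)).Nonempty := fun a => by
    obtain ⟨u, hu, -⟩ := hG a _ (S.centre_mem_cell a)
    exact ⟨u, Or.inl hu⟩
  choose e N he heN using fun a => (hG'f a).exists_enum (hG'ne a)
  obtain ⟨m, hm, hNm⟩ := exists_nat_forall_lt_two_pow N (2 ^ S.size)
  set c : ℕ → X := fun a => e (a % 2 ^ S.size) (a / 2 ^ S.size % 2 ^ m) with hc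
  have hcS : ∀ a, c a ∈ S.cell a := fun a => by
    rw [← S.cell_mod]
    exact hG's _ (he _ _)
  have hchild : ∀ a, ∀ u ∈ G (a % 2 ^ S.size) ∪ ({v} ∩ S.cell (a % 2 ^ S.size)),
      ∃ b, b % 2 ^ S.size = a % 2 ^ S.size ∧ c b = u := fun a u hu => by
    have hlt : a % 2 ^ S.size < 2 ^ S.size := Nat.mod_lt _ (by positivity)
    obtain ⟨i, hi, hiu⟩ := heN _ u hu
    have him := hi.trans_le (hNm _ hlt)
    refine ⟨a % 2 ^ S.size + 2 ^ S.size * i, ?_, ?_⟩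
    · rw [Nat.add_mul_mod_self_left, Nat.mod_mod]
    · simp only [hc]
      rw [Nat.add_mul_mod_self_left, Nat.mod_mod, Nat.add_mul_div_left _ _ (by positivity),
        Nat.div_eq_of_lt hlt, zero_add, Nat.mod_eq_of_lt him, hiu]
  have hcf : (range c).Finite := by
    refine ((finite_Iio (2 ^ S.size)).biUnion fun a _ => hG'f a).subset ?_
    rintro _ ⟨a, rfl⟩
    exact mem_biUnion (Nat.mod_lt _ (by positivity)) (he _ _)
  have hfin : FiniteDimensional ℝ (Submodule.span ℝ (range c)) :=
    FiniteDimensional.span_of_finite ℝ hcf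
  have hcmod : ∀ a, c (a % 2 ^ (S.size + m)) = c a := fun a => by
    simp only [hc]
    rw [Nat.mod_mod_of_dvd _ (pow_dvd_pow 2 (Nat.le_add_right _ _)), pow_add,
      Nat.mod_mul_right_div_self, Nat.mod_mod]
  have hSmod : ∀ a, S.cell (a % 2 ^ (S.size + m)) = S.cell a := fun a => by
    rw [← S.cell_mod, Nat.mod_mod_of_dvd _ (pow_dvd_pow 2 (Nat.le_add_right _ _)), S.cell_mod]
  refine ⟨{ size := S.size + m
            centre := c
            cell := fun a => S.cell a ∩ {y | ∃ e ∈ H, ‖y - c a - e‖ ≤ δ}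
            space := S.space ⊔ Submodule.span ℝ (range c)
            centre_mod := hcmod
            cell_mod := fun a => by rw [hcmod, hSmod]
            centre_mem_cell := fun a => ⟨hcS a, 0, zero_mem _, by simpa using hδ.le⟩
            cell_subset := fun a => inter_subset_left.trans (S.cell_subset a)
            centre_mem_space := fun a =>
              Submodule.mem_sup_right (Submodule.subset_span (mem_range_self a))
            finite_space := inferInstance
            cover := fun y hy => ?_ }, Nat.lt_add_of_pos_right hm, le_sup_left,
          fun a => inter_subset_left, ?_, H, fun a y hy => hy.2,
          fun y hy hy1 => hHb y ⟨hy, by simpa using hy1⟩⟩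
  · obtain ⟨a, ha⟩ := S.cover y hy
    rw [← S.cell_mod] at ha
    obtain ⟨u, hu, e, heH, hue⟩ := hG _ y ha
    obtain ⟨b, hb, hcb⟩ := hchild a u (Or.inl hu)
    refine ⟨b, ?_, e, heH, by rwa [hcb]⟩
    rwa [← S.cell_mod, hb]
  · obtain ⟨a, ha⟩ := S.cover v (by simpa using hv)
    rw [← S.cell_mod] at ha
    obtain ⟨b, -, hcb⟩ := hchild a v (Or.inr ⟨rfl, ha⟩)
    exact ⟨b, hcb⟩

theorem SharpAUS.exists_netLevel_seq (h : SharpAUS C p X) (hη : ∀ k, 0 < η k)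
    (hx : ∀ k, ‖x k‖ ≤ 1) : ∃ S : ℕ → NetLevel X, S 0 = NetLevel.root X ∧
      ∀ k, (S k).Refines C p (η k) (x k) (S (k + 1)) := by
  choose T hT using fun k => NetLevel.exists_refines h (hη k) (hx k)
  exact ⟨fun k => Nat.rec (NetLevel.root X) T k, rfl, fun k => hT k _⟩

theorem NetLevel.cell_antitone {S : ℕ → NetLevel X}
    (hS : ∀ k, (S k).Refines C p (η k) (x k) (S (k + 1))) (a : ℕ) :
    Antitone fun k => (S k).cell a :=
  antitone_nat_of_succ_le fun k => (hS k).2.2.1 a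

theorem NetLevel.space_monotone {S : ℕ → NetLevel X}
    (hS : ∀ k, (S k).Refines C p (η k) (x k) (S (k + 1))) : Monotone fun k => (S k).space :=
  monotone_nat_of_le_succ fun k => (hS k).2.1

theorem NetLevel.size_strictMono {S : ℕ → NetLevel X}
    (hS : ∀ k, (S k).Refines C p (η k) (x k) (S (k + 1))) : StrictMono fun k => (S k).size :=
  strictMono_nat_of_lt_succ fun k => (hS k).1

end NetTree

section LevelOf

variable {L : ℕ → ℕ}

/-- The last index whose value under `L` is at most `n`. -/
def levelOf (L : ℕ → ℕ) (n : ℕ) : ℕ := Nat.findGreatest (fun k => L k ≤ n) n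

theorem levelOf_spec (hL0 : L 0 = 0) (n : ℕ) : L (levelOf L n) ≤ n :=
  Nat.findGreatest_spec (P := fun k => L k ≤ n) (Nat.zero_le n) (by simp [hL0])

theorem levelOf_mono (L : ℕ → ℕ) : Monotone (levelOf L) := fun _ _ h =>
  Nat.findGreatest_mono (fun _ hk => hk.trans h) h

theorem levelOf_apply (hL : StrictMono L) (hL0 : L 0 = 0) (k : ℕ) : levelOf L (L k) = k :=
  le_antisymm (hL.le_iff_le.1 (levelOf_spec hL0 _)) (Nat.le_findGreatest hL.le_apply le_rfl)

/-- Arrays given by a sparse sequence of levels, whose increments are controlled by a bounded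
monotone sequence, belong to `levelArrays q` after repeating levels. -/
theorem levelOf_mem_levelArrays {q : ℝ} (hq : 0 < q) (hL0 : L 0 = 0)
    {c : ℕ → ℕ → ℝ} (hmod : ∀ k a, c k (a % 2 ^ L k) = c k a) {V : ℕ → ℝ} (hV : Monotone V)
    (hV0 : 0 ≤ V 0) (hV1 : ∀ k, V k ≤ 1 / 2) (hc : ∀ k a, |c k a| ^ q ≤ V (k + 1))
    (hinc : ∀ k j a, k < j → |c j a - c k a| ^ q ≤ V (j + 1) - V k) :
    (fun n a => c (levelOf L n) a) ∈ levelArrays q := by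
  have hW : Monotone fun n => V (levelOf L n) + V (levelOf L (n - 1) + 1) := fun n m h => by
    have h1 := hV (levelOf_mono L h)
    have h2 := hV (Nat.succ_le_succ (levelOf_mono L (Nat.sub_le_sub_right h 1)))
    exact add_le_add h1 h2
  have hVnn : ∀ k, 0 ≤ V k := fun k => hV0.trans (hV (Nat.zero_le k))
  refine ⟨fun n a => ?_, _, hW, fun n => add_nonneg (hVnn _) (hVnn _), fun n => ?_, fun n a => ?_,
    fun n m a hnm => ?_⟩
  · dsimp only
    rw [← hmod, Nat.mod_mod_of_dvd _ (pow_dvd_pow 2 (levelOf_spec hL0 n)), hmod]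
  · linarith [hV1 (levelOf L n), hV1 (levelOf L (n - 1) + 1)]
  · dsimp only
    rw [Nat.add_sub_cancel]
    linarith [hc (levelOf L n) a, hVnn (levelOf L (n + 1))]
  · rcases (levelOf_mono L hnm).eq_or_lt with h | h
    · have h1 := hW (hnm.trans (Nat.le_succ m))
      simp only [h, sub_self, abs_zero, Real.zero_rpow hq.ne']
      simp only [h] at h1
      linarith
    · have h1 : levelOf L (n - 1) + 1 ≤ levelOf L (m + 1) :=
        (Nat.succ_le_of_lt ((levelOf_mono L (Nat.sub_le n 1)).trans_lt h)).trans
          (levelOf_mono L (Nat.le_succ m))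
      have h2 := hV h1
      have h3 := hinc _ _ a h
      dsimp only
      rw [Nat.add_sub_cancel]
      linarith

end LevelOf

section Quotient

variable {X : Type*} [NormedAddCommGroup X] [NormedSpace ℝ X] {C p q κ : ℝ} {x : ℕ → X}

theorem NetLevel.rpow_abs_sub_le (hpq : p.HolderConjugate q) (hC : 0 ≤ C) (hκ : 0 < κ)
    (hκ1 : κ ≤ 1) (hCκ : C * κ ^ p ≤ κ) {η : ℕ → ℝ} (hη : ∀ k, 0 < η k) (hη1 : ∀ k, η k ≤ 1)
    {S : ℕ → NetLevel X} (hS : ∀ k, (S k).Refines C p (η k) (x k) (S (k + 1)))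
    {h : StrongDual ℝ X} (hh : ‖h‖ ≤ 1) {k j : ℕ} (hkj : k + 1 ≤ j) (a : ℕ) :
    κ / 4 ^ q * |h ((S j).centre a) - h ((S (k + 1)).centre a)| ^ q ≤
      restrNorm h (S j).space ^ q - restrNorm h (S k).space ^ q + 3 * q * η k := by
  obtain ⟨H, hcell, hH⟩ := (hS k).2.2.2.2
  have hj := NetLevel.cell_antitone hS a hkj ((S j).centre_mem_cell a)
  obtain ⟨e, he, hye⟩ := hcell a _ hj
  have hn : ∀ i, ‖(S i).centre a‖ ≤ 1 := fun i => by
    simpa using (S i).cell_subset a ((S i).centre_mem_cell a)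
  rw [← map_sub]
  refine rpow_abs_apply_le_restrNorm hpq hC hκ hκ1 hCκ
    (NetLevel.space_monotone hS ((Nat.le_succ k).trans hkj)) (hη k) (hη1 k) hH
    (sub_mem ((S j).centre_mem_space a)
      (NetLevel.space_monotone hS hkj ((S (k + 1)).centre_mem_space a))) ?_ he hye hh
  exact (norm_sub_le _ _).trans (by linarith [hn j, hn (k + 1)])

theorem NetLevel.mem_levelArrays (hpq : p.HolderConjugate q) (hC : 0 ≤ C) (hκ : 0 < κ)
    (hκ1 : κ ≤ 1) (hCκ : C * κ ^ p ≤ κ) {S : ℕ → NetLevel X} (hS0 : S 0 = NetLevel.root X)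
    (hS : ∀ k, (S k).Refines C p ((1 / 2) ^ k / (3 * q)) (x k) (S (k + 1)))
    {h : StrongDual ℝ X} (hh : ‖h‖ ≤ 1) :
    (fun n a => (κ / 4 ^ q / 6) ^ (1 / q) *
      h ((S (levelOf (fun k => (S k).size) n)).centre a)) ∈ levelArrays q := by
  have hq := hpq.symm.pos
  have hq1 := hpq.symm.lt
  set c₀ := κ / 4 ^ q with hc₀
  have h4 : 1 ≤ (4 : ℝ) ^ q := Real.one_le_rpow (by norm_num) hq.le
  have hc₀0 : 0 < c₀ := by positivity
  have hc₀1 : c₀ ≤ 1 := div_le_one_of_le₀ (hκ1.trans h4) (by positivity)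
  have hpow : ∀ t : ℝ, |(c₀ / 6) ^ (1 / q) * t| ^ q = c₀ * |t| ^ q / 6 := fun t => by
    rw [abs_mul, abs_of_nonneg (by positivity), Real.mul_rpow (by positivity) (abs_nonneg t),
      ← Real.rpow_mul (by positivity), one_div_mul_cancel hq.ne', Real.rpow_one]
    ring
  have hε : ∀ k : ℕ, 0 < ((1 : ℝ) / 2) ^ k ∧ ((1 : ℝ) / 2) ^ k ≤ 1 := fun k =>
    ⟨by positivity, pow_le_one₀ (by norm_num) (by norm_num)⟩
  have hη : ∀ k : ℕ, 0 < ((1 : ℝ) / 2) ^ k / (3 * q) := fun k => by positivity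
  have hη1 : ∀ k : ℕ, ((1 : ℝ) / 2) ^ k / (3 * q) ≤ 1 := fun k =>
    div_le_one_of_le₀ ((hε k).2.trans (by linarith)) (by positivity)
  have hR : ∀ k, 0 ≤ restrNorm h (S k).space ^ q ∧ restrNorm h (S k).space ^ q ≤ 1 := fun k =>
    ⟨Real.rpow_nonneg (restrNorm_nonneg _ _) _, Real.rpow_le_one (restrNorm_nonneg _ _)
      ((restrNorm_le _ _).trans hh) hq.le⟩
  have hRmono : Monotone fun k => restrNorm h (S k).space ^ q := fun k j hkj =>
    Real.rpow_le_rpow (restrNorm_nonneg _ _)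
      (restrNorm_mono h (NetLevel.space_monotone hS hkj)) hq.le
  have hcj : ∀ j a, c₀ * |h ((S j).centre a)| ^ q ≤ restrNorm h (S j).space ^ q := fun j a => by
    have hn : ‖(S j).centre a‖ ≤ 1 := by
      simpa using (S j).cell_subset a ((S j).centre_mem_cell a)
    have h1 : |h ((S j).centre a)| ≤ restrNorm h (S j).space :=
      (abs_apply_le_restrNorm h ((S j).centre_mem_space a)).trans
        (mul_le_of_le_one_right (restrNorm_nonneg _ _) hn)
    have h2 := Real.rpow_le_rpow (abs_nonneg _) h1 hq.le
    have h3 : 0 ≤ |h ((S j).centre a)| ^ q := by positivity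
    nlinarith
  let V : ℕ → ℝ := fun i => i.casesOn 0 fun k =>
    (restrNorm h (S k).space ^ q + 2 - 2 * (1 / 2) ^ k) / 6
  have hVs : ∀ k, V (k + 1) = (restrNorm h (S k).space ^ q + 2 - 2 * (1 / 2) ^ k) / 6 :=
    fun k => rfl
  have hV0 : V 0 = 0 := rfl
  refine levelOf_mem_levelArrays hq (V := V)
    (c := fun k a => (c₀ / 6) ^ (1 / q) * h ((S k).centre a)) (by simp [hS0, NetLevel.root])
    (fun k a => by simp only [(S k).centre_mod]) ?_ hV0.ge ?_ ?_ ?_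
  · refine monotone_nat_of_le_succ fun i => ?_
    rcases i with _ | k
    · rw [hVs, hV0]
      linarith [(hR 0).1, (hε 0).2]
    · rw [hVs, hVs, pow_succ]
      have := hRmono (Nat.le_succ k)
      dsimp only at this
      linarith [(hε k).1]
  · rintro (_ | k)
    · rw [hV0]
      norm_num
    · rw [hVs]
      linarith [(hR k).2, (hε k).1]
  · intro k a
    rw [hpow, hVs]
    linarith [hcj k a, (hε k).2]
  · rintro (_ | k) j a hkj
    · have : (S 0).centre a = 0 := by rw [hS0]; rfl
      rw [this, map_zero, mul_zero, sub_zero, hpow, hVs, hV0]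
      linarith [hcj j a, (hε j).2]
    · rw [← mul_sub, hpow, hVs, hVs]
      have h1 := NetLevel.rpow_abs_sub_le hpq hC hκ hκ1 hCκ hη hη1 hS hh hkj.le a
      rw [mul_div_cancel₀ _ (by positivity : 3 * q ≠ 0)] at h1
      have h2 : ((1 : ℝ) / 2) ^ j ≤ (1 / 2) ^ (k + 1) :=
        pow_le_pow_of_le_one (by norm_num) (by norm_num) hkj.le
      rw [pow_succ] at h2
      linarith

theorem SharpAUS.isQuotientOf [CompleteSpace X] (hpq : p.HolderConjugate q) (hC : 1 ≤ C)
    (h : SharpAUS C p X) (hx : ∀ k, ‖x k‖ ≤ 1)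
    (hd : ∀ y : X, ‖y‖ ≤ 1 → ∀ ε : ℝ, 0 < ε → ∃ k, ‖y - x k‖ ≤ ε) :
    IsQuotientOf X (Submodule.span ℝ (range (levelVec hpq.symm.pos))).topologicalClosure := by
  have hq := hpq.symm.pos
  obtain ⟨κ, hκ, hκ1, hCκ⟩ := exists_mul_rpow_le hpq.lt hC
  obtain ⟨S, hS0, hS⟩ := h.exists_netLevel_seq
    (fun k => show 0 < ((1 : ℝ) / 2) ^ k / (3 * q) by positivity) hx
  set l : ℝ := (κ / 4 ^ q / 6) ^ (1 / q) with hl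
  have hl0 : 0 < l := by positivity
  set L : ℕ → ℕ := fun k => (S k).size
  set v : ℕ × ℕ → X := fun i => (S (levelOf L i.1)).centre i.2 with hv
  obtain ⟨Q, hQ⟩ := exists_clm_closure_span (d := levelVec hpq.symm.pos) (v := v) (K := l⁻¹)
    fun φ => by
      obtain ⟨f, hf, hfx⟩ := exists_dual_vector'' ℝ (Finsupp.linearCombination ℝ v φ)
      replace hfx : f _ = ‖Finsupp.linearCombination ℝ v φ‖ := hfx
      have hmem := NetLevel.mem_levelArrays hpq (zero_le_one.trans hC) hκ hκ1 hCκ hS0 hS hf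
      have h1 := EllInf.abs_apply_le
        (Finsupp.linearCombination ℝ (levelVec hpq.symm.pos) φ) ⟨_, hmem⟩
      have h2 : Finsupp.linearCombination ℝ (levelVec hpq.symm.pos) φ ⟨_, hmem⟩ =
          l * f (Finsupp.linearCombination ℝ v φ) := by
        clear h1 hfx
        induction φ using Finsupp.induction_linear with
        | zero => simp
        | add φ ψ hφ hψ =>
          rw [map_add, lp.coeFn_add, Pi.add_apply, map_add, map_add, mul_add]
          rw [hφ, hψ]
        | single i t =>
          rw [Finsupp.linearCombination_single, Finsupp.linearCombination_single, lp.coeFn_smul,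
            Pi.smul_apply, levelVec_apply, map_smul, smul_eq_mul, smul_eq_mul]
          ring
      rw [h2, hfx, abs_of_nonneg (by positivity)] at h1
      rwa [← div_eq_inv_mul, le_div_iff₀' hl0]
  refine ⟨Q, Q.surjective_of_dense_unit fun y hy ε hε => ?_⟩
  obtain ⟨k, hk⟩ := hd y hy ε hε
  obtain ⟨a, ha⟩ := (hS k).2.2.2.1
  refine ⟨⟨levelVec hq (L (k + 1), a), Submodule.le_topologicalClosure _
    (Submodule.subset_span (mem_range_self _))⟩, norm_levelVec_le hq _, ?_⟩
  have h1 : levelOf L (L (k + 1)) = k + 1 :=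
    levelOf_apply (NetLevel.size_strictMono hS) (by simp [hS0, NetLevel.root]) _
  rw [hQ, hv]
  dsimp only
  rwa [h1, ha]

end Quotient

theorem exists_dense_unit_seq (X : Type*) [NormedAddCommGroup X] [NormedSpace ℝ X]
    [TopologicalSpace.SeparableSpace X] : ∃ x : ℕ → X, (∀ k, ‖x k‖ ≤ 1) ∧
      ∀ y : X, ‖y‖ ≤ 1 → ∀ ε : ℝ, 0 < ε → ∃ k, ‖y - x k‖ ≤ ε := by
  have : SecondCountableTopology X := UniformSpace.secondCountable_of_separable X
  have : Nonempty (closedBall (0 : X) 1) := ⟨⟨0, by simp⟩⟩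
  refine ⟨fun k => TopologicalSpace.denseSeq (closedBall (0 : X) 1) k,
    fun k => mem_closedBall_zero_iff.1 (TopologicalSpace.denseSeq (closedBall (0 : X) 1) k).2,
    fun y hy ε hε => ?_⟩
  obtain ⟨k, hk⟩ := (TopologicalSpace.denseRange_denseSeq (closedBall (0 : X) 1)).exists_dist_lt
    ⟨y, by simpa using hy⟩ hε
  rw [Subtype.dist_eq, dist_eq_norm] at hk
  exact ⟨k, hk.le⟩

theorem IsomToClosedSubspace.comp {X Y U : Type*} [NormedAddCommGroup X] [NormedSpace ℝ X]
    [NormedAddCommGroup Y] [NormedSpace ℝ Y] [NormedAddCommGroup U] [NormedSpace ℝ U]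
    (h : IsomToClosedSubspace Y U) (h' : IsomToClosedSubspace X Y) :
    IsomToClosedSubspace X U := by
  obtain ⟨T, hT, c, hc, hcT⟩ := h
  obtain ⟨R, hR, b, hb, hbR⟩ := h'
  refine ⟨T.comp R, hT.comp hR, c * b, by positivity, fun y => ?_⟩
  calc c * b * ‖y‖ = c * (b * ‖y‖) := mul_assoc _ _ _
    _ ≤ c * ‖R y‖ := by gcongr; exact hbR y
    _ ≤ ‖T (R y)‖ := hcT _

theorem ContinuousLinearEquiv.isomToClosedSubspace {X Y : Type*} [NormedAddCommGroup X]
    [NormedSpace ℝ X] [NormedAddCommGroup Y] [NormedSpace ℝ Y] (e : X ≃L[ℝ] Y) :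
    IsomToClosedSubspace X Y := by
  set K : ℝ := ‖(e.symm : Y →L[ℝ] X)‖ + 1
  have hK : 0 < K := by positivity
  refine ⟨e, e.injective, K⁻¹, by positivity, fun y => ?_⟩
  rw [inv_mul_le_iff₀ hK]
  calc ‖y‖ = ‖(e.symm : Y →L[ℝ] X) (e y)‖ := by simp
    _ ≤ ‖(e.symm : Y →L[ℝ] X)‖ * ‖e y‖ := ContinuousLinearMap.le_opNorm _ _
    _ ≤ K * ‖e y‖ := by gcongr; exact le_add_of_nonneg_right zero_le_one

/-- For every `p ∈ (1,∞)` there exists a separable Banach space `U` admitting an equivalent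
`p`-AUS norm, such that every separable Banach space admitting an equivalent `p`-AUS norm is
isomorphic to a closed subspace of `U` and is a quotient of `U`. -/
theorem universal_space_for_pAUS (p : ℝ) (hp : 1 < p) :
    ∃ (U : Type) (_ : NormedAddCommGroup U) (_ : NormedSpace ℝ U) (_ : CompleteSpace U),
      TopologicalSpace.SeparableSpace U ∧ PAUSable p U ∧
      ∀ (X : Type u) (_ : NormedAddCommGroup X) (_ : NormedSpace ℝ X) (_ : CompleteSpace X),
        TopologicalSpace.SeparableSpace X → PAUSable p X →
          IsomToClosedSubspace X U ∧ IsQuotientOf X U := by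
  have hpq : p.HolderConjugate p.conjExponent := Real.HolderConjugate.conjExponent hp
  have hθ : ∀ a : ℕ × ℤ, 0 < (2 : ℝ) ^ a.2 := fun a => by positivity
  let U₁ := (Submodule.span ℝ (range (nodeVec hθ hpq.symm.pos))).topologicalClosure
  let U₂ := (Submodule.span ℝ (range (levelVec hpq.symm.pos))).topologicalClosure
  have hc₁ : CompleteSpace U₁ := (Submodule.isClosed_topologicalClosure _).completeSpace_coe
  have hc₂ : CompleteSpace U₂ := (Submodule.isClosed_topologicalClosure _).completeSpace_coe
  have hs₁ : TopologicalSpace.SeparableSpace U₁ := separableSpace_closure_span _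
  have hs₂ : TopologicalSpace.SeparableSpace U₂ := separableSpace_closure_span _
  refine ⟨U₁ × U₂, inferInstance, inferInstance, inferInstance, inferInstance,
    ((ausWith_nodeVec hpq hθ).prod (ausWith_levelVec hpq)).pAUSable one_pos, ?_⟩
  intro X _ _ _ hX hXp
  obtain ⟨Y, _, _, e, C, hC, hY⟩ := hXp.exists_renorming
  have : CompleteSpace Y :=
    (completeSpace_congr (e := e.toEquiv) e.isUniformEmbedding).1 inferInstance
  have : TopologicalSpace.SeparableSpace Y :=
    e.surjective.denseRange.separableSpace e.continuous
  have hsharp := hY.sharp hp hC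
  have hC' : 1 ≤ (1 + C) ^ p := Real.one_le_rpow (by linarith) (by linarith)
  constructor
  · have hx := TopologicalSpace.denseRange_denseSeq Y
    obtain ⟨c, hc, hc1, cov, hcov⟩ := hsharp.exists_isCentredCover hpq hC'
      (TopologicalSpace.denseSeq Y)
    have h1 : IsomToClosedSubspace Y U₁ :=
      (hcov.isFunctionalTree hpq.symm.pos hc hc1).isomToClosedSubspace hθ (by positivity)
        (by positivity) hpq.symm.pos hx
    have h2 : IsomToClosedSubspace U₁ (U₁ × U₂) :=
      ⟨.inl ℝ U₁ U₂, LinearMap.inl_injective, 1, one_pos, fun y => by simp⟩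
    exact (h2.comp h1).comp e.isomToClosedSubspace
  · obtain ⟨x, hx, hd⟩ := exists_dense_unit_seq Y
    obtain ⟨Q, hQ⟩ := hsharp.isQuotientOf hpq hC' hx hd
    exact ⟨(e.symm : Y →L[ℝ] X).comp (Q.comp (.snd ℝ U₁ U₂)),
      e.symm.surjective.comp (hQ.comp Prod.snd_surjective)⟩
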